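/- Let (X,ρ,μ) be a quasi-metric measure space in which μ is Borel regular and Q-doubling for some Q ∈ (0,∞), and let Ω ⊂ X be a μ-measurable locally uniformly perfect set. Suppose there exist s ∈ (0,∞), p ∈ (0,Q/s), q ∈ (0,∞] with s ⪯_q ind(Ω,ρ), and a constant C_P > 0 such that for every ρ-ball B₀ = B_ρ(x₀,R₀) with x₀ ∈ Ω and R₀ ∈ (0,1], and every u ∈ Ṁ^s_{p,q}(Ω,ρ,μ): inf_{γ∈ℝ} ‖u−γ‖_{L^{p*}(B₀∩Ω)} ≤ C_P R₀^s μ(B₀)^{−s/Q} ‖u‖_{Ṁ^s_{p,q}(Ω,ρ,μ)}, where p* := Qp/(Q−sp). Then Ω satisfies the measure density condition. -/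

import Mathlib

open MeasureTheory ENNReal Set

noncomputable section

namespace HajlaszPaper

variable {X : Type*}

/-- The `ρ`-ball centered at `x` with radius `r`. -/
def qball (ρ : X → X → ℝ) (x : X) (r : ℝ) : Set X := {y | ρ x y < r}

/-- `ρ` is a quasi-metric on `X`. -/
def IsQuasiDist (ρ : X → X → ℝ) : Prop :=
  (∀ x y, 0 ≤ ρ x y) ∧ (∀ x y, ρ x y = 0 ↔ x = y) ∧
    (∃ C₀ : ℝ, 1 ≤ C₀ ∧ ∀ x y, ρ y x ≤ C₀ * ρ x y) ∧
    (∃ C₁ : ℝ, 1 ≤ C₁ ∧ ∀ x y z, ρ x y ≤ C₁ * max (ρ x z) (ρ z y))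

/-- The least admissible quasi-triangle constant `C_ρ`. -/
def Crho (ρ : X → X → ℝ) : ℝ :=
  sInf {C : ℝ | 1 ≤ C ∧ ∀ x y z : X, ρ x y ≤ C * max (ρ x z) (ρ z y)}

/-- The least admissible quasi-symmetry constant `C̃_ρ`. -/
def CrhoTilde (ρ : X → X → ℝ) : ℝ :=
  sInf {C : ℝ | 1 ≤ C ∧ ∀ x y : X, ρ y x ≤ C * ρ x y}

/-- Two quasi-metrics are (bi-Lipschitz, i.e. pointwise) equivalent. -/
def EquivQM (ρ ϱ : X → X → ℝ) : Prop :=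
  ∃ c : ℝ, 1 ≤ c ∧ ∀ x y, c⁻¹ * ϱ x y ≤ ρ x y ∧ ρ x y ≤ c * ϱ x y

variable [MeasurableSpace X]

/-- `(X, ρ, μ)` is a quasi-metric measure space. -/
structure IsQMMS (ρ : X → X → ℝ) (μ : Measure X) : Prop where
  nontrivial : ∃ x y : X, x ≠ y
  quasi : IsQuasiDist ρ
  measurableSet_ball : ∀ (x : X) (r : ℝ), 0 < r → MeasurableSet (qball ρ x r)
  ball_pos : ∀ (x : X) (r : ℝ), 0 < r → 0 < μ (qball ρ x r)
  ball_lt_top : ∀ (x : X) (r : ℝ), 0 < r → μ (qball ρ x r) < ∞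

/-- Every `μ`-measurable set is contained in a Borel (measurable) set of equal measure. -/
def BorelRegular (μ : Measure X) : Prop :=
  ∀ A : Set X, ∃ B : Set X, A ⊆ B ∧ MeasurableSet B ∧ μ A = μ B

/-- `μ` is `Q`-doubling. -/
def QDoubling (ρ : X → X → ℝ) (μ : Measure X) (Q : ℝ) : Prop :=
  ∃ κ : ℝ, 0 < κ ∧ ∀ (x y : X) (r R : ℝ), 0 < r → r ≤ R →
    qball ρ x r ⊆ qball ρ y R →
    ENNReal.ofReal (κ * (r / R) ^ Q) * μ (qball ρ y R) ≤ μ (qball ρ x r)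

/-- `μ` is doubling. -/
def DoublingMeas (ρ : X → X → ℝ) (μ : Measure X) : Prop :=
  ∃ Cd : ℝ, 0 < Cd ∧ ∀ (x : X) (r : ℝ), 0 < r →
    μ (qball ρ x (2 * r)) ≤ ENNReal.ofReal Cd * μ (qball ρ x r)

/-- The measure density condition for `Ω`. -/
def MeasDensity (ρ : X → X → ℝ) (μ : Measure X) (Ω : Set X) : Prop :=
  ∃ c : ℝ, 0 < c ∧ ∀ x ∈ Ω, ∀ r : ℝ, 0 < r → r ≤ 1 →
    μ (qball ρ x r) ≤ ENNReal.ofReal c * μ (qball ρ x r ∩ Ω)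

/-- `Ω` is locally uniformly perfect with constant `lam ∈ (0,1)`. -/
def LocUnifPerfect (ρ : X → X → ℝ) (Ω : Set X) (lam : ℝ) : Prop :=
  ∀ x ∈ Ω, ∀ r : ℝ, 0 < r → r ≤ 1 → (Ω \ qball ρ x r).Nonempty →
    ((qball ρ x r ∩ Ω) \ qball ρ x (lam * r)).Nonempty

/-- The critical radius `φ^x_{Ω,ρ}(r)`. -/
def phiRad (ρ : X → X → ℝ) (μ : Measure X) (Ω : Set X) (x : X) (r : ℝ) : ℝ :=
  sSup {t : ℝ | 0 ≤ t ∧ t ≤ r ∧ μ (qball ρ x t ∩ Ω) ≤ μ (qball ρ x r ∩ Ω) / 2}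

/-- The collection `𝔻^s_ρ(u)` of fractional `s`-gradients of `u` on `Ω`. -/
def fracGrad (ρ : X → X → ℝ) (μ : Measure X) (Ω : Set X) (s : ℝ) (u : X → ℝ) :
    Set (ℤ → X → ℝ) :=
  {g | (∀ k x, 0 ≤ g k x) ∧ (∀ k, AEMeasurable (g k) (μ.restrict Ω)) ∧
    ∃ E : Set X, μ E = 0 ∧ ∀ k : ℤ, ∀ x ∈ Ω \ E, ∀ y ∈ Ω \ E,
      (2 : ℝ) ^ (-k - 1) ≤ ρ x y → ρ x y < (2 : ℝ) ^ (-k) →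
      |u x - u y| ≤ ρ x y ^ s * (g k x + g k y)}

/-- `g` is an `s`-gradient of `u` on `S`. -/
def IsSGradOn (ρ : X → X → ℝ) (μ : Measure X) (S : Set X) (s : ℝ) (u g : X → ℝ) : Prop :=
  (∀ x, 0 ≤ g x) ∧ AEMeasurable g (μ.restrict S) ∧
    ∃ E : Set X, μ E = 0 ∧ ∀ x ∈ S \ E, ∀ y ∈ S \ E,
      |u x - u y| ≤ ρ x y ^ s * (g x + g y)

/-- The `ℓ^q` norm (`0 < q ≤ ∞`) of a `ℤ`-indexed sequence in `[0,∞]`. -/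
def lqN (q : ℝ≥0∞) (a : ℤ → ℝ≥0∞) : ℝ≥0∞ :=
  if q = ∞ then ⨆ k, a k else (∑' k, a k ^ q.toReal) ^ (1 / q.toReal)

/-- The `L^p` "norm" (`0 < p < ∞`) of a `[0,∞]`-valued function. -/
def lpN (μ : Measure X) (p : ℝ) (f : X → ℝ≥0∞) : ℝ≥0∞ :=
  (∫⁻ x, f x ^ p ∂μ) ^ (1 / p)

/-- The `L^p` norm of `u : X → ℝ` over the set `Ω`. -/
def lpOn (μ : Measure X) (Ω : Set X) (p : ℝ) (u : X → ℝ) : ℝ≥0∞ :=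
  lpN (μ.restrict Ω) p fun x => ENNReal.ofReal |u x|

/-- The homogeneous Hajłasz–Triebel–Lizorkin quasi-norm `‖u‖_{Ṁ^s_{p,q}(Ω,ρ,μ)}`. -/
def MdotNorm (ρ : X → X → ℝ) (μ : Measure X) (Ω : Set X) (s p : ℝ) (q : ℝ≥0∞)
    (u : X → ℝ) : ℝ≥0∞ :=
  ⨅ g ∈ fracGrad ρ μ Ω s u,
    lpN (μ.restrict Ω) p fun x => lqN q fun k => ENNReal.ofReal (g k x)

/-- The homogeneous Hajłasz–Besov quasi-norm `‖u‖_{Ṅ^s_{p,q}(Ω,ρ,μ)}`. -/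
def NdotNorm (ρ : X → X → ℝ) (μ : Measure X) (Ω : Set X) (s p : ℝ) (q : ℝ≥0∞)
    (u : X → ℝ) : ℝ≥0∞ :=
  ⨅ g ∈ fracGrad ρ μ Ω s u,
    lqN q fun k => lpN (μ.restrict Ω) p fun x => ENNReal.ofReal (g k x)

/-- Membership in `M^s_{p,q}(Ω,ρ,μ)`. -/
def MemMspq (ρ : X → X → ℝ) (μ : Measure X) (Ω : Set X) (s p : ℝ) (q : ℝ≥0∞)
    (u : X → ℝ) : Prop :=
  AEMeasurable u (μ.restrict Ω) ∧ lpOn μ Ω p u ≠ ∞ ∧ MdotNorm ρ μ Ω s p q u ≠ ∞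

/-- Membership in `N^s_{p,q}(Ω,ρ,μ)`. -/
def MemNspq (ρ : X → X → ℝ) (μ : Measure X) (Ω : Set X) (s p : ℝ) (q : ℝ≥0∞)
    (u : X → ℝ) : Prop :=
  AEMeasurable u (μ.restrict Ω) ∧ lpOn μ Ω p u ≠ ∞ ∧ NdotNorm ρ μ Ω s p q u ≠ ∞

/-- The quasi-norm of `M^s_{p,q}(Ω,ρ,μ)`. -/
def MNorm (ρ : X → X → ℝ) (μ : Measure X) (Ω : Set X) (s p : ℝ) (q : ℝ≥0∞)
    (u : X → ℝ) : ℝ≥0∞ :=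
  MdotNorm ρ μ Ω s p q u + lpOn μ Ω p u

/-- The quasi-norm of `N^s_{p,q}(Ω,ρ,μ)`. -/
def NNorm (ρ : X → X → ℝ) (μ : Measure X) (Ω : Set X) (s p : ℝ) (q : ℝ≥0∞)
    (u : X → ℝ) : ℝ≥0∞ :=
  NdotNorm ρ μ Ω s p q u + lpOn μ Ω p u

/-- `s ⪯_q ind(X,ρ)` : there is a quasi-metric `ϱ ≈ ρ` with `s ≤ (log₂ C_ϱ)⁻¹`
(equivalently `C_ϱ ^ s ≤ 2`), where equality is permitted only when `q = ∞`. -/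
def SPrecIndex (ρ : X → X → ℝ) (s : ℝ) (q : ℝ≥0∞) : Prop :=
  ∃ ϱ : X → X → ℝ, IsQuasiDist ϱ ∧ EquivQM ρ ϱ ∧
    (Crho ϱ ^ s < 2 ∨ (q = ∞ ∧ Crho ϱ ^ s ≤ 2))

/-- `s < ind(X,ρ)` : there is a quasi-metric `ϱ ≈ ρ` with `s < (log₂ C_ϱ)⁻¹`
(equivalently `C_ϱ ^ s < 2`). -/
def SLtIndex (ρ : X → X → ℝ) (s : ℝ) : Prop :=
  ∃ ϱ : X → X → ℝ, IsQuasiDist ϱ ∧ EquivQM ρ ϱ ∧ Crho ϱ ^ s < 2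

/-- The median value `m_u(E)`. -/
def medianVal (μ : Measure X) (E : Set X) (u : X → ℝ) : ℝ :=
  sSup {θ : ℝ | μ {x ∈ E | u x < θ} ≤ μ E / 2}

/-- `f` belongs to the homogeneous Hölder space `Ċ^α(X,ρ)`. -/
def MemHolder (ρ : X → X → ℝ) (α : ℝ) (f : X → ℝ) : Prop :=
  ∃ H : ℝ, 0 ≤ H ∧ ∀ x y : X, |f x - f y| ≤ H * ρ x y ^ α

/-- The Hölder seminorm `‖f‖_{Ċ^α(X,ρ)}`. -/
def holderNorm (ρ : X → X → ℝ) (α : ℝ) (f : X → ℝ) : ℝ :=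
  sInf {H : ℝ | 0 ≤ H ∧ ∀ x y : X, |f x - f y| ≤ H * ρ x y ^ α}

/-- The sup norm of `f`. -/
def supNorm (f : X → ℝ) : ℝ := sSup (Set.range fun x => |f x|)

/-- `ρ` is a genuine metric. -/
def IsMetricDist (ρ : X → X → ℝ) : Prop :=
  (∀ x y, 0 ≤ ρ x y) ∧ (∀ x y, ρ x y = 0 ↔ x = y) ∧ (∀ x y, ρ x y = ρ y x) ∧
    (∀ x y z, ρ x y ≤ ρ x z + ρ z y)

/-- The homogeneous Hajłasz–Sobolev quasi-norm `‖u‖_{Ṁ^{1,p}(Ω,ρ,μ)}`. -/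
def M1pDotNorm (ρ : X → X → ℝ) (μ : Measure X) (Ω : Set X) (p : ℝ) (u : X → ℝ) : ℝ≥0∞ :=
  ⨅ g ∈ {g : X → ℝ | IsSGradOn ρ μ Ω 1 u g},
    lpN (μ.restrict Ω) p fun x => ENNReal.ofReal (g x)

/-- Membership in the Hajłasz–Sobolev space `M^{1,p}(Ω,ρ,μ)`. -/
def MemM1p (ρ : X → X → ℝ) (μ : Measure X) (Ω : Set X) (p : ℝ) (u : X → ℝ) : Prop :=
  AEMeasurable u (μ.restrict Ω) ∧ lpOn μ Ω p u ≠ ∞ ∧ M1pDotNorm ρ μ Ω p u ≠ ∞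

/-- The quasi-norm of `M^{1,p}(Ω,ρ,μ)`. -/
def M1pNorm (ρ : X → X → ℝ) (μ : Measure X) (Ω : Set X) (p : ℝ) (u : X → ℝ) : ℝ≥0∞ :=
  lpOn μ Ω p u + M1pDotNorm ρ μ Ω p u


/-- Frink's chain inequality: a `2`-quasi-ultrametric is controlled by four times the length of
chains, with the two end links counted only twice. -/
theorem quasiDist_le_chain_sum {α : Type*} {D : α → α → ℝ} (hnn : ∀ x y, 0 ≤ D x y)
    (htri : ∀ x y z, D x z ≤ 2 * max (D x y) (D y z)) (f : ℕ → α) (L : ℕ) :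
    ∀ m n : ℕ, m < n → n ≤ m + L →
      D (f m) (f (n + 1)) + 2 * D (f m) (f (m + 1)) + 2 * D (f n) (f (n + 1)) ≤
        4 * ∑ i ∈ Finset.Ico m (n + 1), D (f i) (f (i + 1)) := by
  induction L with
  | zero => intro m n h1 h2; omega
  | succ L ih =>
    intro m n hmn hnL
    have hends : D (f m) (f (m + 1)) + D (f n) (f (n + 1)) ≤
        ∑ i ∈ Finset.Ico m (n + 1), D (f i) (f (i + 1)) := by
      rw [Finset.sum_Ico_succ_top hmn.le]
      gcongr
      exact Finset.single_le_sum (f := fun i => D (f i) (f (i + 1))) (fun i _ => hnn _ _)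
        (Finset.left_mem_Ico.2 hmn)
    have hm := hnn (f m) (f (m + 1))
    have hn := hnn (f n) (f (n + 1))
    by_cases hlast : D (f m) (f (n + 1)) ≤ 2 * D (f n) (f (n + 1))
    · linarith
    obtain ⟨k, hmk, hkn, hk, hk'⟩ : ∃ k, m ≤ k ∧ k < n ∧
        D (f m) (f (n + 1)) ≤ 2 * D (f k) (f (n + 1)) ∧
        ¬ D (f m) (f (n + 1)) ≤ 2 * D (f (k + 1)) (f (n + 1)) := by
      by_contra! hcon
      have key : ∀ k, m ≤ k → k ≤ n → D (f m) (f (n + 1)) ≤ 2 * D (f k) (f (n + 1)) := by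
        intro k hk
        induction k, hk using Nat.le_induction with
        | base => intro _; linarith [hnn (f m) (f (n + 1))]
        | succ k hk ihk => intro hkn; exact hcon k hk (by omega) (ihk (by omega))
      exact hlast (key n hmn.le le_rfl)
    have hk'' : D (f m) (f (n + 1)) ≤ 2 * D (f m) (f (k + 1)) := by
      rcases le_total (D (f m) (f (k + 1))) (D (f (k + 1)) (f (n + 1))) with h | h
      · exact absurd ((htri _ (f (k + 1)) _).trans_eq (by rw [max_eq_right h])) hk'
      · exact (htri _ (f (k + 1)) _).trans_eq (by rw [max_eq_left h])
    rcases hmk.eq_or_lt with rfl | hmk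
    · linarith
    have h1 := ih m k hmk (by omega)
    have h2 := ih k n hkn (by omega)
    rw [← Finset.sum_Ico_consecutive _ hmk.le (by omega : k ≤ n + 1)]
    rw [Finset.sum_Ico_succ_top hmk.le] at h1
    linarith

theorem quasiDist_le_four_mul_sum_range {α : Type*} {D : α → α → ℝ} (hnn : ∀ x y, 0 ≤ D x y)
    (htri : ∀ x y z, D x z ≤ 2 * max (D x y) (D y z)) (f : ℕ → α) (n : ℕ) :
    D (f 0) (f (n + 1)) ≤ 4 * ∑ i ∈ Finset.range (n + 1), D (f i) (f (i + 1)) := by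
  rcases Nat.eq_zero_or_pos n with rfl | hn
  · simp only [zero_add, Finset.range_one, Finset.sum_singleton]
    linarith [hnn (f 0) (f 1)]
  · have := quasiDist_le_chain_sum hnn htri f n 0 n hn (by omega)
    rw [Finset.range_eq_Ico]
    linarith [hnn (f 0) (f (0 + 1)), hnn (f n) (f (n + 1))]

theorem exists_chain_eq_sum_zipWith {α : Type*} (D : α → α → NNReal) (l : List α) (x y : α) :
    ∃ (n : ℕ) (f : ℕ → α), f 0 = x ∧ f (n + 1) = y ∧
      ((x :: l).zipWith D (l ++ [y])).sum = ∑ i ∈ Finset.range (n + 1), D (f i) (f (i + 1)) := by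
  induction l generalizing x with
  | nil => exact ⟨0, fun i => if i = 0 then x else y, by simp, by simp, by simp⟩
  | cons a l ih =>
    obtain ⟨n, f, h0, hn, hsum⟩ := ih a
    refine ⟨n + 1, fun i => Nat.casesOn i x f, rfl, hn, ?_⟩
    rw [Finset.sum_range_succ', ← hsum, add_comm]
    simp [h0]

/-- A symmetric `2`-quasi-ultrametric is comparable, up to the factor `4`, to a pseudometric. -/
theorem exists_pseudoMetric_of_quasiDist {α : Type*} {D : α → α → ℝ} (hnn : ∀ x y, 0 ≤ D x y)
    (hself : ∀ x, D x x = 0) (hsymm : ∀ x y, D x y = D y x)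
    (htri : ∀ x y z, D x z ≤ 2 * max (D x y) (D y z)) :
    ∃ m : PseudoMetricSpace α, ∀ x y, m.dist x y ≤ D x y ∧ D x y ≤ 4 * m.dist x y := by
  let E : α → α → NNReal := fun x y => ⟨D x y, hnn x y⟩
  have hE1 : ∀ x, E x x = 0 := fun x => NNReal.eq (hself x)
  have hE2 : ∀ x y, E x y = E y x := fun x y => NNReal.eq (hsymm x y)
  refine ⟨PseudoMetricSpace.ofPreNNDist E hE1 hE2, fun x y =>
    ⟨PseudoMetricSpace.dist_ofPreNNDist_le E hE1 hE2 x y, ?_⟩⟩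
  have key : E x y / 4 ≤ ⨅ l : List α, ((x :: l).zipWith E (l ++ [y])).sum := by
    refine le_ciInf fun l => ?_
    obtain ⟨n, f, h0, hn, hsum⟩ := exists_chain_eq_sum_zipWith E l x y
    have h := quasiDist_le_four_mul_sum_range hnn htri f n
    rw [hsum, div_le_iff₀ (by norm_num), ← NNReal.coe_le_coe]
    push_cast
    rw [h0, hn] at h
    rw [mul_comm]
    exact h
  have h := NNReal.coe_le_coe.2 key
  rw [NNReal.coe_div, div_le_iff₀ (by norm_num), mul_comm] at h
  exact h

theorem le_Crho_mul_max {α : Type*} {ϱ : α → α → ℝ} (h : IsQuasiDist ϱ) (x y z : α) :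
    ϱ x y ≤ Crho ϱ * max (ϱ x z) (ϱ z y) := by
  obtain ⟨hnn, -, -, C, hC1, hC⟩ := h
  have hmax : 0 ≤ max (ϱ x z) (ϱ z y) := le_max_of_le_left (hnn _ _)
  rcases hmax.eq_or_lt with h0 | h0
  · simpa [← h0] using hC x y z
  · rw [← div_le_iff₀ h0]
    refine le_csInf ⟨C, hC1, hC⟩ fun c hc => ?_
    rw [div_le_iff₀ h0]
    exact hc.2 x y z

theorem one_le_Crho {α : Type*} {ϱ : α → α → ℝ} (h : IsQuasiDist ϱ) : 1 ≤ Crho ϱ := by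
  obtain ⟨-, -, -, C, hC1, hC⟩ := h
  exact le_csInf ⟨C, hC1, hC⟩ fun c hc => hc.1

/-- If `ρ` is equivalent to a quasi-metric `ϱ` with `C_ϱ ^ t ≤ 2`, then `ρ ^ t` is comparable to a
pseudometric. -/
theorem exists_pseudoMetric_rpow {α : Type*} {ρ ϱ : α → α → ℝ} (hρ : IsQuasiDist ρ)
    (hϱ : IsQuasiDist ϱ) (heq : EquivQM ρ ϱ) {t : ℝ} (ht : 0 < t) (hC : Crho ϱ ^ t ≤ 2) :
    ∃ (m : PseudoMetricSpace α) (K : ℝ), 1 ≤ K ∧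
      ∀ x y, m.dist x y ≤ K * ρ x y ^ t ∧ ρ x y ^ t ≤ K * m.dist x y := by
  obtain ⟨c, hc1, hc⟩ := heq
  have hnn := hϱ.1
  have hone := one_le_Crho hϱ
  obtain ⟨hρnn, -, ⟨C₀, hC₀1, hC₀⟩, -⟩ := hρ
  have hupper : ∀ x y, ϱ x y ≤ c * ρ x y := fun x y => by
    have := (hc x y).1
    rwa [inv_mul_le_iff₀ (by linarith)] at this
  have hmono : ∀ {a b : ℝ}, 0 ≤ a → a ≤ b → a ^ t ≤ b ^ t := fun ha hab =>
    Real.rpow_le_rpow ha hab ht.le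
  let S : α → α → ℝ := fun x y => max (ϱ x y) (ϱ y x)
  have hSnn : ∀ x y, 0 ≤ S x y := fun x y => le_max_of_le_left (hnn _ _)
  have hStri : ∀ x y z, S x z ≤ Crho ϱ * max (S x y) (S y z) := by
    intro x y z
    refine max_le ((le_Crho_mul_max hϱ x z y).trans ?_) ((le_Crho_mul_max hϱ z x y).trans ?_)
    · gcongr <;> exact le_max_left _ _
    · rw [max_comm]
      gcongr <;> exact le_max_right _ _
  obtain ⟨m, hm⟩ := exists_pseudoMetric_of_quasiDist (D := fun x y => S x y ^ t)
    (fun x y => Real.rpow_nonneg (hSnn x y) t)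
    (fun x => by simp [S, (hϱ.2.1 x x).2 rfl, Real.zero_rpow ht.ne'])
    (fun x y => by simp only [S, max_comm])
    (fun x y z => by
      calc S x z ^ t ≤ (Crho ϱ * max (S x y) (S y z)) ^ t := hmono (hSnn _ _) (hStri x y z)
        _ = Crho ϱ ^ t * max (S x y) (S y z) ^ t :=
            Real.mul_rpow (by linarith) (le_max_of_le_left (hSnn _ _))
        _ ≤ 2 * max (S x y) (S y z) ^ t := by
            gcongr
            exact Real.rpow_nonneg (le_max_of_le_left (hSnn _ _)) t
        _ = 2 * max (S x y ^ t) (S y z ^ t) := by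
            congr 1
            rcases le_total (S x y) (S y z) with h | h
            · rw [max_eq_right h, max_eq_right (hmono (hSnn _ _) h)]
            · rw [max_eq_left h, max_eq_left (hmono (hSnn _ _) h)])
  have hcC : 1 ≤ (c * C₀) ^ t := Real.one_le_rpow (one_le_mul_of_one_le_of_one_le hc1 hC₀1) ht.le
  refine ⟨m, 4 * (c * C₀) ^ t, by linarith, fun x y => ⟨?_, ?_⟩⟩
  · have hS : S x y ≤ c * C₀ * ρ x y := by
      have h0 := hρnn x y
      refine max_le ((hupper x y).trans ?_) ((hupper y x).trans ?_)
      · nlinarith [mul_nonneg (sub_nonneg.2 hC₀1) (mul_nonneg (by linarith : 0 ≤ c) h0)]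
      · rw [mul_assoc]
        gcongr
        exact hC₀ x y
    calc m.dist x y ≤ S x y ^ t := (hm x y).1
      _ ≤ (c * C₀ * ρ x y) ^ t := hmono (hSnn _ _) hS
      _ = (c * C₀) ^ t * ρ x y ^ t := Real.mul_rpow (by positivity) (hρnn x y)
      _ ≤ 4 * (c * C₀) ^ t * ρ x y ^ t := by
          have := Real.rpow_nonneg (hρnn x y) t
          nlinarith [mul_nonneg (by linarith : 0 ≤ (c * C₀) ^ t) this]
  · have hρS : ρ x y ≤ c * C₀ * S x y := by
      have hS0 := hSnn x y
      calc ρ x y ≤ c * ϱ x y := (hc x y).2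
        _ ≤ c * S x y := by gcongr; exact le_max_left _ _
        _ ≤ c * C₀ * S x y := by
            nlinarith [mul_nonneg (sub_nonneg.2 hC₀1) (mul_nonneg (by linarith : 0 ≤ c) hS0)]
    calc ρ x y ^ t ≤ (c * C₀ * S x y) ^ t := hmono (hρnn _ _) hρS
      _ = (c * C₀) ^ t * S x y ^ t := Real.mul_rpow (by positivity) (hSnn x y)
      _ ≤ (c * C₀) ^ t * (4 * m.dist x y) := by gcongr; exact (hm x y).2
      _ = 4 * (c * C₀) ^ t * m.dist x y := by ring

/-- An exponent `t ≥ s`, strictly larger unless `q = ∞`, for which a power `t` of `ρ` is comparable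
to a pseudometric. -/
theorem exists_pseudoMetric_of_sPrecIndex {α : Type*} {ρ : α → α → ℝ} (hρ : IsQuasiDist ρ)
    {s : ℝ} (hs : 0 < s) {q : ℝ≥0∞} (hind : SPrecIndex ρ s q) :
    ∃ t, s ≤ t ∧ (q ≠ ∞ → s < t) ∧ ∃ (m : PseudoMetricSpace α) (K : ℝ), 1 ≤ K ∧
      ∀ x y, m.dist x y ≤ K * ρ x y ^ t ∧ ρ x y ^ t ≤ K * m.dist x y := by
  obtain ⟨ϱ, hϱ, heq, hlt | ⟨hq, hle⟩⟩ := hind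
  · have hone := one_le_Crho hϱ
    have hcont : ContinuousAt (fun t : ℝ => Crho ϱ ^ t) s :=
      Real.continuousAt_const_rpow (by linarith)
    have hev := (hcont.eventually_lt continuousAt_const hlt)
    obtain ⟨ε, hε, h⟩ := Metric.eventually_nhds_iff.1 hev
    refine ⟨s + ε / 2, by linarith, fun _ => by linarith,
      exists_pseudoMetric_rpow hρ hϱ heq (by linarith) (h ?_).le⟩
    rw [Real.dist_eq, add_sub_cancel_left, abs_of_pos (by linarith)]
    linarith
  · exact ⟨s, le_rfl, fun h => absurd hq h, exists_pseudoMetric_rpow hρ hϱ heq hs hle⟩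

theorem IsQMMS.sigmaFinite {ρ : X → X → ℝ} {μ : Measure X} (hX : IsQMMS ρ μ) : SigmaFinite μ := by
  obtain ⟨x₀, -, -⟩ := hX.nontrivial
  refine ⟨⟨⟨fun n : ℕ => qball ρ x₀ (n + 1), fun _ => trivial,
    fun n => hX.ball_lt_top _ _ (by positivity), ?_⟩⟩⟩
  refine Set.eq_univ_of_forall fun z => Set.mem_iUnion.2 ?_
  obtain ⟨n, hn⟩ := exists_nat_gt (ρ x₀ z)
  exact ⟨n, show ρ x₀ z < n + 1 by linarith⟩

/-- Positivity and finiteness of the measure of balls force separability. -/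
theorem IsQMMS.exists_countable_dense {ρ : X → X → ℝ} {μ : Measure X} (hX : IsQMMS ρ μ)
    (Ω : Set X) : ∃ D ⊆ Ω, D.Countable ∧ ∀ z ∈ Ω, ∀ ε : ℝ, 0 < ε → ∃ a ∈ D, ρ a z < ε := by
  have := hX.sigmaFinite
  obtain ⟨-, hself, ⟨C₀, hC₀1, hC₀⟩, C₁, hC₁1, hC₁⟩ := hX.quasi
  have key : ∀ ε : ℝ, 0 < ε → ∃ D ⊆ Ω, D.Countable ∧ ∀ z ∈ Ω, ∃ a ∈ D, ρ a z < ε := by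
    intro ε hε
    have hδ : 0 < ε / (C₁ * C₀) := by positivity
    obtain ⟨D, hDΩ, hdisj, hcov⟩ := Vitali.exists_disjoint_subfamily_covering_enlargement
      (fun a => qball ρ a (ε / (C₁ * C₀))) Ω (fun _ => 1) 2 one_lt_two (fun _ _ => zero_le_one) 1
      (fun _ _ => le_rfl) (fun a _ => ⟨a, by simpa [qball, (hself a a).2 rfl] using hδ⟩)
    refine ⟨D, hDΩ, ?_, fun z hz => ?_⟩
    · have hc := Measure.countable_meas_pos_of_disjoint_iUnion (μ := μ)
        (As := fun a : D => qball ρ (a : X) (ε / (C₁ * C₀)))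
        (fun a => hX.measurableSet_ball _ _ hδ)
        (fun a b hab => hdisj a.2 b.2 (fun h => hab (Subtype.ext h)))
      exact Set.countable_coe_iff.1 (Set.countable_univ_iff.1
        (hc.mono fun a _ => hX.ball_pos (a : X) _ hδ))
    · obtain ⟨a, ha, ⟨w, hzw, haw⟩, -⟩ := hcov z hz
      refine ⟨a, ha, ?_⟩
      have hzw : ρ z w < ε / (C₁ * C₀) := hzw
      have haw : ρ a w < ε / (C₁ * C₀) := haw
      have h1 : ρ w z < ε / C₁ := by
        calc ρ w z ≤ C₀ * ρ z w := hC₀ z w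
          _ < C₀ * (ε / (C₁ * C₀)) := by gcongr
          _ = ε / C₁ := by field_simp
      have h2 : ρ a w < ε / C₁ := haw.trans_le (by
        gcongr
        exact le_mul_of_one_le_right (by linarith) hC₀1)
      calc ρ a z ≤ C₁ * max (ρ a w) (ρ w z) := hC₁ a z w
        _ < C₁ * (ε / C₁) := by gcongr; exact max_lt h2 h1
        _ = ε := by field_simp
  choose! D hDΩ hDc hD using key
  refine ⟨⋃ n : ℕ, D (1 / (n + 1)), Set.iUnion_subset fun n => hDΩ _ (by positivity),
    Set.countable_iUnion fun n => hDc _ (by positivity), fun z hz ε hε => ?_⟩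
  obtain ⟨n, hn⟩ := exists_nat_one_div_lt hε
  obtain ⟨a, ha, haz⟩ := hD (1 / (n + 1)) (by positivity) z hz
  exact ⟨a, Set.mem_iUnion.2 ⟨n, ha⟩, haz.trans hn⟩

/-- Sublevel sets of functions that are Hölder continuous on `Ω` are measurable. -/
theorem IsQMMS.measurableSet_sublevel {ρ : X → X → ℝ} {μ : Measure X} (hX : IsQMMS ρ μ)
    {Ω : Set X} (hΩ : MeasurableSet Ω) {K t : ℝ} (hK : 0 < K) (ht : 0 < t) {h : X → ℝ}
    (hh : ∀ y ∈ Ω, ∀ z ∈ Ω, |h z - h y| ≤ K * ρ y z ^ t) (c : ℝ) :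
    MeasurableSet {z ∈ Ω | h z < c} := by
  obtain ⟨D, hDΩ, hDc, hD⟩ := hX.exists_countable_dense Ω
  have hρ : ∀ a, Measurable (ρ a) := fun a => measurable_of_Iio fun r => by
    rcases le_or_gt r 0 with hr | hr
    · rw [show ρ a ⁻¹' Iio r = ∅ from Set.eq_empty_of_forall_notMem fun z hz =>
        (hX.quasi.1 a z).not_gt (lt_of_lt_of_le hz hr)]
      exact MeasurableSet.empty
    · exact hX.measurableSet_ball a r hr
  have heq : {z ∈ Ω | h z < c} = Ω ∩ ⋃ a ∈ D, {z | h a + K * ρ a z ^ t < c} := by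
    ext z
    simp only [Set.mem_ofPred_eq, Set.mem_inter_iff, Set.mem_iUnion, exists_prop]
    refine and_congr_right fun hz => ⟨fun hzc => ?_, fun ⟨a, ha, hac⟩ => ?_⟩
    · have hpos : 0 < (c - h z) / (2 * K) := div_pos (by linarith) (by linarith)
      obtain ⟨a, ha, haz⟩ := hD z hz (((c - h z) / (2 * K)) ^ t⁻¹) (Real.rpow_pos_of_pos hpos _)
      refine ⟨a, ha, ?_⟩
      have h1 : ρ a z ^ t < (c - h z) / (2 * K) := by
        have := Real.rpow_lt_rpow (hX.quasi.1 a z) haz ht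
        rwa [Real.rpow_inv_rpow hpos.le ht.ne'] at this
      rw [lt_div_iff₀ (by linarith)] at h1
      have h2 := (abs_le.1 (hh a (hDΩ ha) z hz)).1
      nlinarith
    · have := (abs_le.1 (hh a (hDΩ ha) z hz)).2
      linarith
  rw [heq]
  refine hΩ.inter (MeasurableSet.biUnion hDc fun a _ => ?_)
  exact measurableSet_lt (measurable_const.add (((hρ a).pow_const t).const_mul K)) measurable_const

theorem IsQMMS.aemeasurable_of_holder {ρ : X → X → ℝ} {μ : Measure X} (hX : IsQMMS ρ μ)
    {Ω : Set X} (hΩ : MeasurableSet Ω) {K t : ℝ} (hK : 0 < K) (ht : 0 < t) {h : X → ℝ}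
    (hh : ∀ y ∈ Ω, ∀ z ∈ Ω, |h z - h y| ≤ K * ρ y z ^ t) :
    AEMeasurable h (μ.restrict Ω) := by
  rw [aemeasurable_restrict_iff_comap_subtype hΩ]
  refine (measurable_of_Iio fun c => ?_).aemeasurable
  refine ⟨_, hX.measurableSet_sublevel hΩ hK ht hh c, ?_⟩
  ext z
  simp

theorem lqN_comp_add_right (q : ℝ≥0∞) (a : ℤ → ℝ≥0∞) (n : ℤ) :
    lqN q (fun k => a (k + n)) = lqN q a := by
  unfold lqN
  split_ifs
  · exact (Equiv.addRight n).iSup_comp (g := a)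
  · rw [← (Equiv.addRight n).tsum_eq (fun k => a k ^ q.toReal)]
    rfl

theorem lqN_const_mul (q : ℝ≥0∞) (hq : 0 < q) (c : ℝ≥0∞) (a : ℤ → ℝ≥0∞) :
    lqN q (fun k => c * a k) = c * lqN q a := by
  unfold lqN
  split_ifs with h
  · rw [ENNReal.mul_iSup]
  · have hq' : 0 < q.toReal := ENNReal.toReal_pos hq.ne' h
    simp_rw [ENNReal.mul_rpow_of_nonneg _ _ hq'.le]
    rw [ENNReal.tsum_mul_left, ENNReal.mul_rpow_of_nonneg _ _ (by positivity), ← ENNReal.rpow_mul,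
      mul_one_div_cancel hq'.ne', ENNReal.rpow_one]

theorem lqN_zero (q : ℝ≥0∞) (hq : 0 < q) : lqN q (fun _ => 0) = 0 := by
  simpa using lqN_const_mul q hq 0 (fun _ => 0)

theorem lpN_indicator_const (μ : Measure X) {p : ℝ} (hp : 0 < p) {Ω U : Set X} (hUΩ : U ⊆ Ω)
    (hU : MeasurableSet U) (c : ℝ≥0∞) :
    lpN (μ.restrict Ω) p (U.indicator fun _ => c) = c * μ U ^ (1 / p) := by
  unfold lpN
  have : (fun x => U.indicator (fun _ => c) x ^ p) = U.indicator fun _ => c ^ p := by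
    ext x
    by_cases hx : x ∈ U <;> simp [hx, hp]
  rw [this, lintegral_indicator hU, setLIntegral_const, Measure.restrict_apply hU,
    Set.inter_eq_left.2 hUΩ, ENNReal.mul_rpow_of_nonneg _ _ (by positivity), ← ENNReal.rpow_mul,
    mul_one_div_cancel hp.ne', ENNReal.rpow_one]

/-- Two-sided geometrically decaying weights on the dyadic scales. -/
def scaleWeight (η : ℝ) (j : ℤ) : ℝ := 2 ^ (-(η * |(j : ℝ)|))

theorem scaleWeight_pos (η : ℝ) (j : ℤ) : 0 < scaleWeight η j :=
  Real.rpow_pos_of_pos two_pos _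

theorem lqN_scaleWeight_ne_top {q : ℝ≥0∞} (hq : 0 < q) {η : ℝ} (hη : 0 ≤ η)
    (hη' : q ≠ ∞ → 0 < η) : lqN q (fun j => ENNReal.ofReal (scaleWeight η j)) ≠ ∞ := by
  unfold lqN
  split_ifs with h
  · refine ne_top_of_le_ne_top ENNReal.one_ne_top (iSup_le fun j => ?_)
    rw [ENNReal.ofReal_le_one]
    exact Real.rpow_le_one_of_one_le_of_nonpos one_le_two
      (neg_nonpos.2 (mul_nonneg hη (abs_nonneg _)))
  · have hq' : 0 < q.toReal := ENNReal.toReal_pos hq.ne' h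
    refine ENNReal.rpow_ne_top_of_nonneg (by positivity) ?_
    have heq : ∀ j : ℤ, ENNReal.ofReal (scaleWeight η j) ^ q.toReal =
        ENNReal.ofReal (((2 : ℝ) ^ (-(η * q.toReal))) ^ j.natAbs) := fun j => by
      rw [ENNReal.ofReal_rpow_of_pos (scaleWeight_pos _ _), scaleWeight, ← Real.rpow_mul two_pos.le,
        ← Real.rpow_natCast, ← Real.rpow_mul two_pos.le, Nat.cast_natAbs, Int.cast_abs]
      ring_nf
    simp_rw [heq]
    refine Summable.tsum_ofReal_ne_top ?_
    have hgeo : Summable fun n : ℕ => ((2 : ℝ) ^ (-(η * q.toReal))) ^ n :=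
      summable_geometric_of_lt_one (by positivity)
        (Real.rpow_lt_one_of_one_lt_of_neg one_lt_two (neg_neg_of_pos (mul_pos (hη' h) hq')))
    refine Summable.of_nat_of_neg ?_ ?_ <;> simpa using hgeo

theorem min_one_le_mul_scaleWeight {s t K η r L : ℝ} {n k : ℤ} (hs : 0 < s) (hK : 0 < K)
    (hηs : η ≤ s) (hηt : η ≤ t - s) (hst : s ≤ t) (hr : 0 < r) (hL : 0 < L)
    (hLn : (2 : ℝ) ^ n ≤ L) (hLn' : L < (2 : ℝ) ^ (n + 1))
    (hk : (2 : ℝ) ^ (-k - 1) ≤ r) (hk' : r < (2 : ℝ) ^ (-k)) :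
    min 1 (K * (r / L) ^ t) ≤ (K + 4 ^ s) * (r / L) ^ s * scaleWeight η (k + n) := by
  have hrL : 0 < r / L := div_pos hr hL
  have h4 : (0 : ℝ) < 4 ^ s := Real.rpow_pos_of_pos (by norm_num) _
  have hrLs : 0 < (r / L) ^ s := Real.rpow_pos_of_pos hrL _
  rcases le_or_gt 0 (k + n) with hj | hj
  · refine (min_le_right _ _).trans ?_
    have hj' : (0 : ℝ) ≤ ((k + n : ℤ) : ℝ) := by exact_mod_cast hj
    have h1 : r / L ≤ (2 : ℝ) ^ (-((k + n : ℤ) : ℝ)) := by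
      rw [← Int.cast_neg, Real.rpow_intCast, div_le_iff₀ hL]
      calc r ≤ (2 : ℝ) ^ (-k) := hk'.le
        _ = (2 : ℝ) ^ (-(k + n)) * 2 ^ n := by
            rw [← zpow_add₀ two_ne_zero]; congr 1; ring
        _ ≤ (2 : ℝ) ^ (-(k + n)) * L := by gcongr
    have h2 : (r / L) ^ (t - s) ≤ scaleWeight η (k + n) := by
      calc (r / L) ^ (t - s) ≤ ((2 : ℝ) ^ (-((k + n : ℤ) : ℝ))) ^ (t - s) :=
            Real.rpow_le_rpow hrL.le h1 (by linarith)
        _ = (2 : ℝ) ^ (-((k + n : ℤ) : ℝ) * (t - s)) := by rw [← Real.rpow_mul two_pos.le]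
        _ ≤ scaleWeight η (k + n) := by
            rw [scaleWeight, abs_of_nonneg hj']
            exact Real.rpow_le_rpow_of_exponent_le one_le_two (by nlinarith)
    calc K * (r / L) ^ t = K * (r / L) ^ s * (r / L) ^ (t - s) := by
          rw [mul_assoc, ← Real.rpow_add hrL, add_sub_cancel]
      _ ≤ (K + 4 ^ s) * (r / L) ^ s * scaleWeight η (k + n) := by
          gcongr
          linarith
  · refine (min_le_left _ _).trans ?_
    have hj' : ((k + n : ℤ) : ℝ) < 0 := by exact_mod_cast hj
    have h1 : (2 : ℝ) ^ (-((k + n : ℤ) : ℝ)) ≤ 4 * (r / L) := by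
      rw [← Int.cast_neg, Real.rpow_intCast, ← mul_div_assoc, le_div_iff₀ hL]
      calc (2 : ℝ) ^ (-(k + n)) * L ≤ (2 : ℝ) ^ (-(k + n)) * 2 ^ (n + 1) := by gcongr
        _ = 4 * (2 : ℝ) ^ (-k - 1) := by
            rw [show (4 : ℝ) = 2 ^ (2 : ℤ) by norm_num, ← zpow_add₀ two_ne_zero,
              ← zpow_add₀ two_ne_zero]
            congr 1; ring
        _ ≤ 4 * r := by gcongr
    have h2 : 1 ≤ (4 * (r / L)) ^ s * scaleWeight η (k + n) := by
      calc (1 : ℝ) ≤ (2 : ℝ) ^ ((s - η) * |((k + n : ℤ) : ℝ)|) :=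
            Real.one_le_rpow one_le_two (mul_nonneg (by linarith) (abs_nonneg _))
        _ = ((2 : ℝ) ^ (-((k + n : ℤ) : ℝ))) ^ s * scaleWeight η (k + n) := by
            rw [scaleWeight, ← Real.rpow_mul two_pos.le, ← Real.rpow_add two_pos,
              abs_of_neg hj']
            congr 1; ring
        _ ≤ (4 * (r / L)) ^ s * scaleWeight η (k + n) := by
            have := (scaleWeight_pos η (k + n)).le
            gcongr
    refine h2.trans ?_
    rw [Real.mul_rpow (by norm_num) hrL.le]
    have := (scaleWeight_pos η (k + n)).le
    gcongr
    linarith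

/-- The cut-off function equal to `1` where `h ≤ T - Δ` and to `0` where `T ≤ h`. -/
def cutoff {α : Type*} (h : α → ℝ) (T Δ : ℝ) (z : α) : ℝ := max 0 (min 1 ((T - h z) / Δ))

theorem cutoff_eq_zero {α : Type*} {h : α → ℝ} {T Δ : ℝ} (hΔ : 0 < Δ) {z : α} (hz : T ≤ h z) :
    cutoff h T Δ z = 0 :=
  max_eq_left ((min_le_right _ _).trans (div_nonpos_of_nonpos_of_nonneg (by linarith) hΔ.le))

theorem cutoff_eq_one {α : Type*} {h : α → ℝ} {T Δ : ℝ} (hΔ : 0 < Δ) {z : α} (hz : h z ≤ T - Δ) :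
    cutoff h T Δ z = 1 := by
  have : 1 ≤ (T - h z) / Δ := by rw [le_div_iff₀ hΔ]; linarith
  rw [cutoff, min_eq_left this, max_eq_right zero_le_one]

theorem abs_cutoff_sub_le {α : Type*} (h : α → ℝ) (T : ℝ) {Δ : ℝ} (hΔ : 0 < Δ) (y z : α) :
    |cutoff h T Δ y - cutoff h T Δ z| ≤ min 1 (|h y - h z| / Δ) := by
  refine le_min ?_ ?_
  · have h0 : ∀ w, 0 ≤ cutoff h T Δ w := fun w => le_max_left _ _
    have h1 : ∀ w, cutoff h T Δ w ≤ 1 := fun w => max_le zero_le_one (min_le_left _ _)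
    rw [abs_le]
    constructor <;> linarith [h0 y, h0 z, h1 y, h1 z]
  · calc |cutoff h T Δ y - cutoff h T Δ z|
        ≤ |min 1 ((T - h y) / Δ) - min 1 ((T - h z) / Δ)| := by
          have := abs_max_sub_max_le_abs (min 1 ((T - h y) / Δ)) (min 1 ((T - h z) / Δ)) 0
          rwa [max_comm _ (0 : ℝ), max_comm _ (0 : ℝ)] at this
      _ ≤ |(T - h y) / Δ - (T - h z) / Δ| := by
          have := abs_min_sub_min_le_max 1 ((T - h y) / Δ) 1 ((T - h z) / Δ)
          simpa using this
      _ = |h y - h z| / Δ := by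
          rw [← sub_div, abs_div, abs_of_pos hΔ, _root_.sub_sub_sub_cancel_left, abs_sub_comm]

theorem exists_mdotNorm_cutoff_le {ρ : X → X → ℝ} {μ : Measure X} (hX : IsQMMS ρ μ) {Ω : Set X}
    (hΩ : MeasurableSet Ω) {s t p K : ℝ} {q : ℝ≥0∞} (hs : 0 < s) (hst : s ≤ t)
    (hst' : q ≠ ∞ → s < t) (hp : 0 < p) (hq : 0 < q) (hK : 0 < K) :
    ∃ W : ℝ, 0 < W ∧ ∀ h : X → ℝ, (∀ y ∈ Ω, ∀ z ∈ Ω, |h z - h y| ≤ K * ρ y z ^ t) →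
      ∀ T Δ : ℝ, 0 < Δ → MdotNorm ρ μ Ω s p q (cutoff h T Δ) ≤
        ENNReal.ofReal (W * Δ ^ (-(s / t))) * μ {z ∈ Ω | h z < T} ^ (1 / p) := by
  have ht : 0 < t := hs.trans_le hst
  set η := min s (t - s) with hηdef
  have hη0 : 0 ≤ η := le_min hs.le (by linarith)
  have hfin := lqN_scaleWeight_ne_top hq hη0
    (fun hq' => lt_min hs (by linarith [hst' hq']))
  set N := lqN q (fun j => ENNReal.ofReal (scaleWeight η j)) with hN
  have h4 : (0 : ℝ) < 4 ^ s := Real.rpow_pos_of_pos (by norm_num) _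
  refine ⟨(K + 4 ^ s) * (N.toReal + 1), by positivity, fun h hh T Δ hΔ => ?_⟩
  set U := {z ∈ Ω | h z < T} with hUdef
  have hU : MeasurableSet U := hX.measurableSet_sublevel hΩ hK ht hh T
  have hL : 0 < Δ ^ t⁻¹ := Real.rpow_pos_of_pos hΔ _
  have hLt : (Δ ^ t⁻¹) ^ t = Δ := Real.rpow_inv_rpow hΔ.le ht.ne'
  have hLs : (Δ ^ t⁻¹) ^ s = Δ ^ (s / t) := by
    rw [← Real.rpow_mul hΔ.le]; congr 1; field_simp
  obtain ⟨n, hn, hn'⟩ := exists_mem_Ico_zpow hL (one_lt_two (α := ℝ))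
  set A := (K + 4 ^ s) * Δ ^ (-(s / t)) with hA
  have hA0 : 0 < A := mul_pos (by positivity) (Real.rpow_pos_of_pos hΔ _)
  let g : ℤ → X → ℝ := fun k => U.indicator fun _ => A * scaleWeight η (k + n)
  have hgnn : ∀ k x, 0 ≤ g k x := fun k x =>
    Set.indicator_nonneg (fun _ _ => (mul_pos hA0 (scaleWeight_pos _ _)).le) x
  have hg : g ∈ fracGrad ρ μ Ω s (cutoff h T Δ) := by
    refine ⟨hgnn, fun k => (measurable_const.indicator hU).aemeasurable, ∅, measure_empty, ?_⟩
    rintro k y ⟨hy, -⟩ z ⟨hz, -⟩ hk hk'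
    have hr : 0 < ρ y z := lt_of_lt_of_le (zpow_pos two_pos _) hk
    have hrs : 0 < ρ y z ^ s := Real.rpow_pos_of_pos hr _
    by_cases hyz : T ≤ h y ∧ T ≤ h z
    · rw [cutoff_eq_zero hΔ hyz.1, cutoff_eq_zero hΔ hyz.2, sub_self, abs_zero]
      exact mul_nonneg hrs.le (add_nonneg (hgnn _ _) (hgnn _ _))
    have hgsum : A * scaleWeight η (k + n) ≤ g k y + g k z := by
      rw [not_and_or, not_le, not_le] at hyz
      rcases hyz with hy' | hz'
      · have : g k y = A * scaleWeight η (k + n) :=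
          Set.indicator_of_mem (s := U) ⟨hy, hy'⟩ _
        linarith [hgnn k z]
      · have : g k z = A * scaleWeight η (k + n) :=
          Set.indicator_of_mem (s := U) ⟨hz, hz'⟩ _
        linarith [hgnn k y]
    calc |cutoff h T Δ y - cutoff h T Δ z| ≤ min 1 (|h y - h z| / Δ) := abs_cutoff_sub_le _ _ hΔ _ _
      _ ≤ min 1 (K * (ρ y z / Δ ^ t⁻¹) ^ t) := by
          rw [Real.div_rpow hr.le hL.le, hLt, ← mul_div_assoc, abs_sub_comm]
          gcongr
          exact hh y hy z hz
      _ ≤ (K + 4 ^ s) * (ρ y z / Δ ^ t⁻¹) ^ s * scaleWeight η (k + n) :=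
          min_one_le_mul_scaleWeight hs hK (min_le_left _ _) (min_le_right _ _) hst hr hL hn hn'
            hk hk'
      _ = ρ y z ^ s * (A * scaleWeight η (k + n)) := by
          rw [Real.div_rpow hr.le hL.le, hLs, hA, Real.rpow_neg hΔ.le]
          ring
      _ ≤ ρ y z ^ s * (g k y + g k z) := by gcongr
  refine (iInf₂_le g hg).trans ?_
  have hlq : (fun x => lqN q fun k => ENNReal.ofReal (g k x)) =
      U.indicator fun _ => ENNReal.ofReal A * N := by
    ext x
    by_cases hx : x ∈ U
    · simp only [g, Set.indicator_of_mem hx, ENNReal.ofReal_mul hA0.le]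
      rw [lqN_const_mul q hq,
        lqN_comp_add_right q (fun j => ENNReal.ofReal (scaleWeight η j)) n]
    · simp only [g, Set.indicator_of_notMem hx, ENNReal.ofReal_zero]
      exact lqN_zero q hq
  rw [hlq, lpN_indicator_const μ hp (Set.sep_subset _ _) hU]
  gcongr
  calc ENNReal.ofReal A * N = ENNReal.ofReal (A * N.toReal) := by
        rw [ENNReal.ofReal_mul hA0.le, ENNReal.ofReal_toReal hfin]
    _ ≤ _ := by
        refine ENNReal.ofReal_le_ofReal ?_
        rw [hA]
        have := Real.rpow_pos_of_pos hΔ (-(s / t))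
        nlinarith [mul_pos (by positivity : 0 < K + 4 ^ s) this]

/-- A growth bound for a left-continuous monotone function, obtained by iterated halving. -/
theorem le_mul_rpow_of_halving {m : ℝ → ℝ} {T A σ : ℝ} (hT : 0 < T) (hσ : 0 < σ)
    (hm0 : m 0 = 0) (hmono : ∀ a b, 0 ≤ a → a ≤ b → b ≤ T → m a ≤ m b)
    (hpos : ∀ a, 0 < a → a ≤ T → 0 < m a)
    (hleft : ∀ a v, 0 < a → a ≤ T → (∀ b, 0 ≤ b → b < a → m b ≤ v) → m a ≤ v)
    (hA : 0 ≤ A)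
    (hstep : ∀ a b, 0 ≤ a → a < b → b ≤ T → m b ≤ 2 * m a → b - a ≤ A * m b ^ σ) :
    T ≤ A / (1 - 2 ^ (-σ)) * m T ^ σ := by
  have h2 : (2 : ℝ) ^ (-σ) < 1 := Real.rpow_lt_one_of_one_lt_of_neg one_lt_two (by linarith)
  set B := A / (1 - 2 ^ (-σ)) with hB
  have hB0 : 0 ≤ B := div_nonneg hA (by linarith)
  have hBA : A - B = -(B * 2 ^ (-σ)) := by
    have : B * (1 - 2 ^ (-σ)) = A := div_mul_cancel₀ _ (by linarith)
    linarith
  have hnn : ∀ a, 0 ≤ a → a ≤ T → 0 ≤ m a := fun a h h' => hm0 ▸ hmono 0 a le_rfl h h'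
  set I := {a | 0 ≤ a ∧ a ≤ T ∧ T - B * m T ^ σ ≤ a - B * m a ^ σ} with hI
  have hTI : T ∈ I := ⟨hT.le, le_rfl, le_rfl⟩
  have hbdd : BddBelow I := ⟨0, fun a ha => ha.1⟩
  set c := sInf I with hc
  have hc0 : 0 ≤ c := le_csInf ⟨T, hTI⟩ fun a ha => ha.1
  have hcT : c ≤ T := csInf_le hbdd hTI
  have hcI : T - B * m T ^ σ ≤ c - B * m c ^ σ := by
    have : T - B * m T ^ σ + B * m c ^ σ ≤ c := by
      refine le_csInf ⟨T, hTI⟩ fun a ha => ?_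
      have h1 : m c ^ σ ≤ m a ^ σ :=
        Real.rpow_le_rpow (hnn c hc0 hcT) (hmono c a hc0 (csInf_le hbdd ha) ha.2.1) hσ.le
      have := mul_le_mul_of_nonneg_left h1 hB0
      linarith [ha.2.2]
    linarith
  rcases hc0.eq_or_lt with h0 | hcpos
  · rw [← h0, hm0, Real.zero_rpow hσ.ne'] at hcI
    linarith
  exfalso
  have hmc := hpos c hcpos hcT
  set S := {a | 0 ≤ a ∧ a ≤ c ∧ m a ≤ m c / 2} with hS
  have h0S : (0 : ℝ) ∈ S := ⟨le_rfl, hc0, by rw [hm0]; linarith⟩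
  have hSbdd : BddAbove S := ⟨c, fun a ha => ha.2.1⟩
  set b := sSup S with hb
  have hb0 : 0 ≤ b := le_csSup hSbdd h0S
  have hbc : b ≤ c := csSup_le ⟨0, h0S⟩ fun a ha => ha.2.1
  have hmb : m b ≤ m c / 2 := by
    rcases hb0.eq_or_lt with h | h
    · rw [← h, hm0]; linarith
    · refine hleft b _ h (hbc.trans hcT) fun a ha hab => ?_
      obtain ⟨a', ha', haa'⟩ := exists_lt_of_lt_csSup ⟨0, h0S⟩ hab
      exact (hmono a a' ha haa'.le (ha'.2.1.trans hcT)).trans ha'.2.2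
  have hbc' : b < c := lt_of_le_of_ne hbc fun h => by rw [h] at hmb; linarith
  have hcb : c - b ≤ A * m c ^ σ := by
    refine le_of_forall_pos_le_add fun ε hε => ?_
    obtain ⟨a, hba, hac⟩ := exists_between (lt_min hbc' (by linarith : b < b + ε))
    have hac' := hac.trans_le (min_le_left _ _)
    have haε := hac.trans_le (min_le_right _ _)
    have hma : m c ≤ 2 * m a := by
      by_contra! hcon
      have : a ≤ b := le_csSup hSbdd ⟨hb0.trans hba.le, hac'.le, by linarith⟩
      linarith
    linarith [hstep a c (hb0.trans hba.le) hac' hcT hma]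
  have hbI : b ∈ I := by
    refine ⟨hb0, hbc.trans hcT, hcI.trans ?_⟩
    have h1 : m b ^ σ ≤ 2 ^ (-σ) * m c ^ σ := by
      calc m b ^ σ ≤ (m c / 2) ^ σ := Real.rpow_le_rpow (hnn b hb0 (hbc.trans hcT)) hmb hσ.le
        _ = 2 ^ (-σ) * m c ^ σ := by
          rw [Real.div_rpow hmc.le two_pos.le, Real.rpow_neg two_pos.le]; ring
    have h2 := mul_le_mul_of_nonneg_left h1 hB0
    have h3 : (A - B) * m c ^ σ = -(B * 2 ^ (-σ)) * m c ^ σ := by rw [hBA]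
    linarith
  exact absurd (csInf_le hbdd hbI) (not_le.2 hbc')

/-- A function equal to `1` and to `0` on large subsets is far from constants. -/
theorem half_mul_rpow_le_lpOn_sub {μ : Measure X} {S E F : Set X} (hE : MeasurableSet E)
    (hF : MeasurableSet F) (hES : E ⊆ S) (hFS : F ⊆ S) {P : ℝ} (hP : 0 < P) {v : ℝ≥0∞}
    (hvE : v ≤ μ E) (hvF : v ≤ μ F) {u : X → ℝ} (huE : ∀ z ∈ E, u z = 1)
    (huF : ∀ z ∈ F, u z = 0) (γ : ℝ) :
    ENNReal.ofReal (1 / 2) * v ^ (1 / P) ≤ lpOn μ S P (fun x => u x - γ) := by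
  have key : ∀ G : Set X, MeasurableSet G → G ⊆ S → v ≤ μ G → (∀ z ∈ G, 1 / 2 ≤ |u z - γ|) →
      ENNReal.ofReal (1 / 2) * v ^ (1 / P) ≤ lpOn μ S P (fun x => u x - γ) := by
    intro G hG hGS hv hu
    have h1 : ENNReal.ofReal (1 / 2) ^ P * v ≤
        ∫⁻ x in S, ENNReal.ofReal |u x - γ| ^ P ∂μ := by
      calc ENNReal.ofReal (1 / 2) ^ P * v ≤ ENNReal.ofReal (1 / 2) ^ P * μ G := by gcongr
        _ = ∫⁻ _ in G, ENNReal.ofReal (1 / 2) ^ P ∂μ := (setLIntegral_const _ _).symm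
        _ ≤ ∫⁻ x in G, ENNReal.ofReal |u x - γ| ^ P ∂μ :=
            setLIntegral_mono' hG fun z hz => by gcongr; exact hu z hz
        _ ≤ ∫⁻ x in S, ENNReal.ofReal |u x - γ| ^ P ∂μ := lintegral_mono_set hGS
    calc ENNReal.ofReal (1 / 2) * v ^ (1 / P)
        = (ENNReal.ofReal (1 / 2) ^ P * v) ^ (1 / P) := by
          rw [ENNReal.mul_rpow_of_nonneg _ _ (by positivity), ← ENNReal.rpow_mul,
            mul_one_div_cancel hP.ne', ENNReal.rpow_one]
      _ ≤ _ := ENNReal.rpow_le_rpow h1 (by positivity)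
  rcases le_total γ (1 / 2) with h | h
  · refine key E hE hES hvE fun z hz => ?_
    rw [huE z hz]
    exact le_trans (by linarith) (le_abs_self _)
  · refine key F hF hFS hvF fun z hz => ?_
    rw [huF z hz]
    exact le_trans (by linarith) (neg_le_abs _)

theorem le_mul_rpow_of_poincare {s t p Q C W R Δ a b : ℝ} (hs : 0 < s) (ht : 0 < t) (hp : 0 < p)
    (hQ : 0 < Q) (hC : 0 < C) (hW : 0 < W) (hR : 0 < R) (hΔ : 0 < Δ)
    (ha : 0 < a) (hb : 0 < b) (hsp : s * p < Q)
    (h : 1 / 2 * (a / 2) ^ (1 / (Q * p / (Q - s * p))) ≤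
      C * R ^ s / b ^ (s / Q) * (W * Δ ^ (-(s / t)) * a ^ (1 / p))) :
    Δ ≤ (2 * 2 ^ (1 / (Q * p / (Q - s * p))) * C * W) ^ (t / s) * R ^ t / b ^ (t / Q) *
      a ^ (t / Q) := by
  have hP : 1 / p = 1 / (Q * p / (Q - s * p)) + s / Q := by
    have : Q - s * p ≠ 0 := by linarith
    field_simp
    ring
  set e := 1 / (Q * p / (Q - s * p)) with he
  set C' := 2 * 2 ^ e * C * W with hC'
  have hC'0 : 0 < C' := by positivity
  have hae : 0 < a ^ e := Real.rpow_pos_of_pos ha _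
  have hΔs : 0 < Δ ^ (s / t) := Real.rpow_pos_of_pos hΔ _
  have hbs : 0 < b ^ (s / Q) := Real.rpow_pos_of_pos hb _
  have h1 : Δ ^ (s / t) ≤ C' * R ^ s / b ^ (s / Q) * a ^ (s / Q) := by
    rw [hP, Real.rpow_add ha, Real.div_rpow ha.le two_pos.le, Real.rpow_neg hΔ.le] at h
    have h2e : (0 : ℝ) < 2 ^ e := Real.rpow_pos_of_pos two_pos _
    have h3 := mul_le_mul_of_nonneg_left h (by positivity : 0 ≤ 2 * 2 ^ e * Δ ^ (s / t) / a ^ e)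
    have h4 : 2 * 2 ^ e * Δ ^ (s / t) / a ^ e * (1 / 2 * (a ^ e / 2 ^ e)) = Δ ^ (s / t) := by
      field_simp
    have h5 : 2 * 2 ^ e * Δ ^ (s / t) / a ^ e * (C * R ^ s / b ^ (s / Q) *
        (W * (Δ ^ (s / t))⁻¹ * (a ^ e * a ^ (s / Q)))) =
        C' * R ^ s / b ^ (s / Q) * a ^ (s / Q) := by
      rw [hC']
      field_simp
    rwa [h4, h5] at h3
  have h2 := Real.rpow_le_rpow hΔs.le h1 (by positivity : 0 ≤ t / s)
  have hst : s / t * (t / s) = 1 := by field_simp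
  have hsQ : s / Q * (t / s) = t / Q := by field_simp
  have hss : s * (t / s) = t := by field_simp
  rw [← Real.rpow_mul hΔ.le, hst, Real.rpow_one, Real.mul_rpow (by positivity) (by positivity),
    Real.div_rpow (by positivity) (by positivity), Real.mul_rpow (by positivity) (by positivity),
    ← Real.rpow_mul hb.le, ← Real.rpow_mul ha.le, ← Real.rpow_mul hR.le, hsQ, hss] at h2
  exact h2

/-- If a Poincaré inequality holds and the sublevel set `{h < T}` of a Hölder function has at most
the mass of its complement in the ball, then `T` is controlled by the mass of the sublevel set. -/
theorem exists_le_mul_rpow_measure_sublevel {ρ : X → X → ℝ} {μ : Measure X} (hX : IsQMMS ρ μ)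
    {Ω : Set X} (hΩ : MeasurableSet Ω) {Q s t p K C : ℝ} {q : ℝ≥0∞} (hQ : 0 < Q) (hs : 0 < s)
    (hst : s ≤ t) (hst' : q ≠ ∞ → s < t) (hp : 0 < p) (hsp : s * p < Q) (hq : 0 < q) (hK : 0 < K)
    (hC : 0 < C)
    (hpoin : ∀ x₀ ∈ Ω, ∀ R₀ : ℝ, 0 < R₀ → R₀ ≤ 1 →
      ∀ u : X → ℝ, AEMeasurable u (μ.restrict Ω) → MdotNorm ρ μ Ω s p q u ≠ ∞ →
        (⨅ γ : ℝ, lpOn μ (qball ρ x₀ R₀ ∩ Ω) (Q * p / (Q - s * p))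
            (fun x => u x - γ)) ≤
          (ENNReal.ofReal (C * R₀ ^ s) / μ (qball ρ x₀ R₀) ^ (s / Q)) *
            MdotNorm ρ μ Ω s p q u) :
    ∃ A : ℝ, 0 < A ∧ ∀ x ∈ Ω, ∀ R : ℝ, 0 < R → R ≤ 1 → ∀ h : X → ℝ,
      (∀ y ∈ Ω, ∀ z ∈ Ω, |h z - h y| ≤ K * ρ y z ^ t) → (∀ z ∈ Ω, 0 ≤ h z) →
      (∀ τ : ℝ, 0 < τ → 0 < μ {z ∈ Ω | h z < τ}) →
      ∀ T : ℝ, 0 < T → {z ∈ Ω | h z < T} ⊆ qball ρ x R →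
        μ {z ∈ Ω | h z < T} ≤ μ ((qball ρ x R ∩ Ω) \ {z ∈ Ω | h z < T}) →
        T ≤ A * R ^ t / (μ (qball ρ x R)).toReal ^ (t / Q) *
          (μ {z ∈ Ω | h z < T}).toReal ^ (t / Q) := by
  have ht : 0 < t := hs.trans_le hst
  have hPpos : 0 < Q * p / (Q - s * p) := div_pos (mul_pos hQ hp) (by linarith)
  obtain ⟨W, hW, hWbd⟩ := exists_mdotNorm_cutoff_le hX hΩ hs hst hst' hp hq hK
  have h2 : (2 : ℝ) ^ (-(t / Q)) < 1 :=
    Real.rpow_lt_one_of_one_lt_of_neg one_lt_two (neg_neg_of_pos (div_pos ht hQ))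
  refine ⟨(2 * 2 ^ (1 / (Q * p / (Q - s * p))) * C * W) ^ (t / s) / (1 - 2 ^ (-(t / Q))),
    div_pos (by positivity) (by linarith), ?_⟩
  intro x hx R hR hR1 h hh hnn hpos T hT hsub hhalf
  set U : ℝ → Set X := fun τ => {z ∈ Ω | h z < τ} with hU
  have hUm : ∀ τ, MeasurableSet (U τ) := fun τ => hX.measurableSet_sublevel hΩ hK ht hh τ
  have hUmono : ∀ {a b}, a ≤ b → U a ⊆ U b := fun hab z hz => ⟨hz.1, hz.2.trans_le hab⟩
  have hBtop := (hX.ball_lt_top x R hR).ne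
  have hUtop : ∀ {τ}, τ ≤ T → μ (U τ) ≠ ∞ := fun hτ =>
    ne_top_of_le_ne_top hBtop (measure_mono ((hUmono hτ).trans hsub))
  have hbpos : 0 < (μ (qball ρ x R)).toReal := ENNReal.toReal_pos (hX.ball_pos x R hR).ne' hBtop
  have hBm := hX.measurableSet_ball x R hR
  have := le_mul_rpow_of_halving (m := fun τ => (μ (U τ)).toReal) (T := T) (σ := t / Q)
    (A := (2 * 2 ^ (1 / (Q * p / (Q - s * p))) * C * W) ^ (t / s) * R ^ t /
      (μ (qball ρ x R)).toReal ^ (t / Q)) hT (div_pos ht hQ) ?_ ?_ ?_ ?_ (by positivity) ?_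
  · refine this.trans_eq ?_
    ring
  · have : U 0 = ∅ := Set.eq_empty_of_forall_notMem fun z hz => (hnn z hz.1).not_gt hz.2
    simp [this]
  · exact fun a b _ hab hb => ENNReal.toReal_mono (hUtop hb) (measure_mono (hUmono hab))
  · exact fun a ha haT => ENNReal.toReal_pos (hpos a ha).ne' (hUtop haT)
  · intro a v ha haT hv
    have hv0 : 0 ≤ v := ENNReal.toReal_nonneg.trans (hv 0 le_rfl ha)
    refine ENNReal.toReal_le_of_le_ofReal hv0 ?_
    have hunion : U a = ⋃ n : ℕ, U (a - a * (1 / (n + 1))) := by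
      refine Set.Subset.antisymm (fun z hz => Set.mem_iUnion.2 ?_)
        (Set.iUnion_subset fun n => hUmono (sub_le_self _ (by positivity)))
      have hz2 : h z < a := hz.2
      obtain ⟨n, hn⟩ := exists_nat_one_div_lt (div_pos (sub_pos.2 hz2) ha)
      rw [lt_div_iff₀ ha] at hn
      exact ⟨n, hz.1, by linarith⟩
    rw [hunion, Monotone.measure_iUnion]
    · refine iSup_le fun n => ?_
      have hlt : a - a * (1 / ((n : ℝ) + 1)) < a := sub_lt_self _ (by positivity)
      have hn1 : 1 / ((n : ℝ) + 1) ≤ 1 := by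
        rw [div_le_one (by positivity)]
        linarith [Nat.cast_nonneg (α := ℝ) n]
      exact (ENNReal.le_ofReal_iff_toReal_le (hUtop (hlt.le.trans haT)) hv0).2
        (hv _ (by nlinarith) hlt)
    · intro n k hnk
      refine hUmono ?_
      gcongr
  · intro a b ha hab hbT hmab
    have hΔ : 0 < b - a := sub_pos.2 hab
    have hb0 : 0 < b := ha.trans_lt hab
    have hbd := hWbd h hh b (b - a) hΔ
    have hrtop : ENNReal.ofReal (W * (b - a) ^ (-(s / t))) * μ (U b) ^ (1 / p) ≠ ∞ :=
      ENNReal.mul_ne_top ENNReal.ofReal_ne_top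
        (ENNReal.rpow_ne_top_of_nonneg (by positivity) (hUtop hbT))
    have hmeas : AEMeasurable (cutoff h b (b - a)) (μ.restrict Ω) := by
      have := hX.aemeasurable_of_holder hΩ hK ht hh
      exact aemeasurable_const.max
        (aemeasurable_const.min ((aemeasurable_const.sub this).div_const (b - a)))
    have hpo := hpoin x hx R hR hR1 _ hmeas (ne_top_of_le_ne_top hrtop hbd)
    have hlow : ENNReal.ofReal (1 / 2) * (μ (U b) / 2) ^ (1 / (Q * p / (Q - s * p))) ≤
        ⨅ γ : ℝ, lpOn μ (qball ρ x R ∩ Ω) (Q * p / (Q - s * p))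
          (fun z => cutoff h b (b - a) z - γ) := by
      refine le_iInf fun γ => half_mul_rpow_le_lpOn_sub (E := U a)
        (F := (qball ρ x R ∩ Ω) \ U b) (hUm a) ((hBm.inter hΩ).diff (hUm b))
        (Set.subset_inter ((hUmono (hab.le.trans hbT)).trans hsub) (Set.sep_subset _ _))
        Set.sdiff_subset hPpos ?_ ?_
        (fun z hz => cutoff_eq_one hΔ (by linarith [hz.2]))
        (fun z hz => cutoff_eq_zero hΔ (not_lt.1 fun hlt => hz.2 ⟨hz.1.2, hlt⟩)) γ
      · rw [ENNReal.div_le_iff two_ne_zero ENNReal.ofNat_ne_top]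
        rw [← ENNReal.toReal_le_toReal (hUtop hbT)
          (ENNReal.mul_ne_top (hUtop (hab.le.trans hbT)) ENNReal.ofNat_ne_top),
          ENNReal.toReal_mul, mul_comm]
        exact hmab
      · calc μ (U b) / 2 ≤ μ (U b) := ENNReal.half_le_self
          _ ≤ μ (U T) := measure_mono (hUmono hbT)
          _ ≤ μ ((qball ρ x R ∩ Ω) \ U T) := hhalf
          _ ≤ μ ((qball ρ x R ∩ Ω) \ U b) :=
              measure_mono (Set.sdiff_subset_sdiff_right (hUmono hbT))
    have hchain := (hlow.trans hpo).trans (mul_le_mul_right hbd _)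
    have hdtop : ENNReal.ofReal (C * R ^ s) / μ (qball ρ x R) ^ (s / Q) ≠ ∞ :=
      ENNReal.div_ne_top ENNReal.ofReal_ne_top
        (ENNReal.rpow_pos (hX.ball_pos x R hR) hBtop).ne'
    have hreal := ENNReal.toReal_mono (ENNReal.mul_ne_top hdtop hrtop) hchain
    have hCR : 0 ≤ C * R ^ s := by positivity
    have hWΔ : 0 ≤ W * (b - a) ^ (-(s / t)) := by positivity
    simp only [ENNReal.toReal_mul, ENNReal.toReal_div, ← ENNReal.toReal_rpow,
      ENNReal.toReal_ofReal hCR, ENNReal.toReal_ofReal hWΔ,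
      ENNReal.toReal_ofReal (by norm_num : (0 : ℝ) ≤ 1 / 2), ENNReal.toReal_ofNat] at hreal
    exact le_mul_rpow_of_poincare hs ht hp hQ hC hW hR hΔ
      (ENNReal.toReal_pos (hpos b hb0).ne' (hUtop hbT)) hbpos hsp hreal

/-- `d` behaves on `Ω` like a pseudometric comparable to `ρ ^ t`. -/
structure IsSnowflake {α : Type*} (ρ : α → α → ℝ) (Ω : Set α) (t K : ℝ) (d : α → α → ℝ) :
    Prop where
  nonneg : ∀ x ∈ Ω, ∀ y ∈ Ω, 0 ≤ d x y
  symm : ∀ x ∈ Ω, ∀ y ∈ Ω, d x y = d y x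
  triangle : ∀ x ∈ Ω, ∀ y ∈ Ω, ∀ z ∈ Ω, d x z ≤ d x y + d y z
  le_rpow : ∀ x ∈ Ω, ∀ y ∈ Ω, d x y ≤ K * ρ x y ^ t
  rpow_le : ∀ x ∈ Ω, ∀ y ∈ Ω, ρ x y ^ t ≤ K * d x y

theorem exists_isSnowflake {α : Type*} {ρ : α → α → ℝ} (hρ : IsQuasiDist ρ) (Ω : Set α) {s : ℝ}
    (hs : 0 < s) {q : ℝ≥0∞} (hind : SPrecIndex (fun a b : Ω => ρ a.1 b.1) s q) :
    ∃ t, s ≤ t ∧ (q ≠ ∞ → s < t) ∧ ∃ (K : ℝ) (d : α → α → ℝ), 1 ≤ K ∧ IsSnowflake ρ Ω t K d := by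
  classical
  obtain ⟨h0, h1, ⟨C₀, hC₀1, hC₀⟩, C₁, hC₁1, hC₁⟩ := hρ
  have hρΩ : IsQuasiDist (fun a b : Ω => ρ a.1 b.1) :=
    ⟨fun _ _ => h0 _ _, fun x y => (h1 x y).trans Subtype.ext_iff.symm,
      ⟨C₀, hC₀1, fun _ _ => hC₀ _ _⟩, C₁, hC₁1, fun _ _ _ => hC₁ _ _ _⟩
  obtain ⟨t, hst, hst', m, K, hK, hm⟩ := exists_pseudoMetric_of_sPrecIndex hρΩ hs hind
  let d : α → α → ℝ := fun x y =>
    if hx : x ∈ Ω then if hy : y ∈ Ω then m.dist ⟨x, hx⟩ ⟨y, hy⟩ else 0 else 0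
  have hd : ∀ {x y} (hx : x ∈ Ω) (hy : y ∈ Ω), d x y = m.dist ⟨x, hx⟩ ⟨y, hy⟩ :=
    fun hx hy => by simp only [d, dif_pos hx, dif_pos hy]
  refine ⟨t, hst, hst', K, d, hK, ?_, ?_, ?_, ?_, ?_⟩
  · intro x hx y hy
    rw [hd hx hy]
    exact dist_nonneg
  · intro x hx y hy
    rw [hd hx hy, hd hy hx]
    exact m.dist_comm _ _
  · intro x hx y hy z hz
    rw [hd hx hy, hd hy hz, hd hx hz]
    exact m.dist_triangle _ _ _
  · intro x hx y hy
    rw [hd hx hy]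
    exact (hm ⟨x, hx⟩ ⟨y, hy⟩).1
  · intro x hx y hy
    rw [hd hx hy]
    exact (hm ⟨x, hx⟩ ⟨y, hy⟩).2

theorem IsSnowflake.abs_sub_le {α : Type*} {ρ d : α → α → ℝ} {Ω : Set α} {t K : ℝ}
    (hd : IsSnowflake ρ Ω t K d) {x : α} (hx : x ∈ Ω) :
    ∀ y ∈ Ω, ∀ z ∈ Ω, |d x z - d x y| ≤ K * ρ y z ^ t := by
  intro y hy z hz
  refine le_trans ?_ (hd.le_rpow y hy z hz)
  rw [abs_le]
  have h1 := hd.triangle x hx y hy z hz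
  have h2 := hd.triangle x hx z hz y hy
  rw [hd.symm z hz y hy] at h2
  constructor <;> linarith

theorem le_ofReal_inv_mul {k : ℝ} (hk : 0 < k) {a b : ℝ≥0∞} (h : ENNReal.ofReal k * a ≤ b) :
    a ≤ ENNReal.ofReal k⁻¹ * b := by
  calc a = ENNReal.ofReal k⁻¹ * (ENNReal.ofReal k * a) := by
        rw [← mul_assoc, ← ENNReal.ofReal_mul (by positivity), inv_mul_cancel₀ hk.ne',
          ENNReal.ofReal_one, one_mul]
    _ ≤ _ := by gcongr

/-- Measure density at a point whose `d`-ball carries at most half of the mass of a comparable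
`ρ`-ball, in the presence of a Poincaré inequality. -/
theorem IsSnowflake.exists_measure_qball_le {ρ d : X → X → ℝ} {μ : Measure X} (hX : IsQMMS ρ μ)
    {Ω : Set X} (hΩ : MeasurableSet Ω)
    (hΩpos : ∀ x ∈ Ω, ∀ r : ℝ, 0 < r → r ≤ 1 → 0 < μ (qball ρ x r ∩ Ω))
    {Q s t p K C α : ℝ} {q : ℝ≥0∞} (hd : IsSnowflake ρ Ω t K d) (hQ : 0 < Q) (hs : 0 < s)
    (hst : s ≤ t) (hst' : q ≠ ∞ → s < t) (hp : 0 < p) (hsp : s * p < Q) (hq : 0 < q) (hK : 0 < K)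
    (hC : 0 < C) (hα : 0 < α)
    (hpoin : ∀ x₀ ∈ Ω, ∀ R₀ : ℝ, 0 < R₀ → R₀ ≤ 1 →
      ∀ u : X → ℝ, AEMeasurable u (μ.restrict Ω) → MdotNorm ρ μ Ω s p q u ≠ ∞ →
        (⨅ γ : ℝ, lpOn μ (qball ρ x₀ R₀ ∩ Ω) (Q * p / (Q - s * p))
            (fun x => u x - γ)) ≤
          (ENNReal.ofReal (C * R₀ ^ s) / μ (qball ρ x₀ R₀) ^ (s / Q)) *
            MdotNorm ρ μ Ω s p q u) :
    ∃ B : ℝ, 0 < B ∧ ∀ x ∈ Ω, ∀ R : ℝ, 0 < R → R ≤ 1 → ∀ T : ℝ, α * R ^ t ≤ T →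
      {z ∈ Ω | d x z < T} ⊆ qball ρ x R →
      μ {z ∈ Ω | d x z < T} ≤ μ ((qball ρ x R ∩ Ω) \ {z ∈ Ω | d x z < T}) →
      μ (qball ρ x R) ≤ ENNReal.ofReal B * μ {z ∈ Ω | d x z < T} := by
  have ht : 0 < t := hs.trans_le hst
  obtain ⟨A, hA, hAbd⟩ := exists_le_mul_rpow_measure_sublevel hX hΩ hQ hs hst hst' hp hsp hq hK hC
    hpoin
  have hσ : 0 < t / Q := div_pos ht hQ
  refine ⟨(A / α) ^ (t / Q)⁻¹, Real.rpow_pos_of_pos (div_pos hA hα) _, ?_⟩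
  intro x hx R hR hR1 T hαT hsub hhalf
  have hRt : 0 < R ^ t := Real.rpow_pos_of_pos hR _
  have hpos : ∀ τ : ℝ, 0 < τ → 0 < μ {z ∈ Ω | d x z < τ} := by
    intro τ hτ
    have hτK : 0 < τ / K := div_pos hτ hK
    have hr : 0 < min 1 ((τ / K) ^ t⁻¹) := lt_min one_pos (Real.rpow_pos_of_pos hτK _)
    refine (hΩpos x hx _ hr (min_le_left _ _)).trans_le (measure_mono fun z hz => ⟨hz.2, ?_⟩)
    have hz1 : ρ x z < (τ / K) ^ t⁻¹ := lt_of_lt_of_le hz.1 (min_le_right _ _)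
    have h1 := Real.rpow_lt_rpow (hX.quasi.1 x z) hz1 ht
    rw [Real.rpow_inv_rpow hτK.le ht.ne', lt_div_iff₀ hK] at h1
    linarith [hd.le_rpow x hx z hz.2]
  have h := hAbd x hx R hR hR1 (d x) (hd.abs_sub_le hx) (hd.nonneg x hx) hpos T
    (lt_of_lt_of_le (by positivity) hαT) hsub hhalf
  have hbtop := (hX.ball_lt_top x R hR).ne
  have hUtop := ne_top_of_le_ne_top hbtop (measure_mono hsub)
  set b := (μ (qball ρ x R)).toReal with hb
  set a := (μ {z ∈ Ω | d x z < T}).toReal with ha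
  have ha0 : 0 ≤ a := ENNReal.toReal_nonneg
  have hb0 : 0 < b := ENNReal.toReal_pos (hX.ball_pos x R hR).ne' hbtop
  have hbσ : 0 < b ^ (t / Q) := Real.rpow_pos_of_pos hb0 _
  have h1 : b ^ (t / Q) ≤ A / α * a ^ (t / Q) := by
    have h2 : α * R ^ t ≤ A * R ^ t / b ^ (t / Q) * a ^ (t / Q) := hαT.trans h
    rw [div_mul_eq_mul_div, le_div_iff₀ hbσ] at h2
    rw [div_mul_eq_mul_div, le_div_iff₀ hα]
    refine le_of_mul_le_mul_left ?_ hRt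
    linarith
  have h2 : b ≤ (A / α) ^ (t / Q)⁻¹ * a := by
    have h3 := Real.rpow_le_rpow hbσ.le h1 (inv_nonneg.2 hσ.le)
    rwa [Real.mul_rpow (by positivity) (by positivity), Real.rpow_rpow_inv hb0.le hσ.ne',
      Real.rpow_rpow_inv ha0 hσ.ne'] at h3
  rw [← ENNReal.ofReal_toReal hbtop, ← ENNReal.ofReal_toReal hUtop,
    ← ENNReal.ofReal_mul (by positivity)]
  exact ENNReal.ofReal_le_ofReal h2

/-- The measure density estimate at radii for which the ball does not exhaust `Ω`. -/
theorem IsSnowflake.exists_measure_qball_le_inter {ρ d : X → X → ℝ} {μ : Measure X}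
    (hX : IsQMMS ρ μ) {Ω : Set X} {Q t K lam : ℝ} (hdoub : QDoubling ρ μ Q)
    (ht : 0 < t) (hK : 1 ≤ K) (hlam0 : 0 < lam) (hlam1 : lam < 1)
    (hperf : LocUnifPerfect ρ Ω lam) (hd : IsSnowflake ρ Ω t K d)
    (hdens : ∀ α : ℝ, 0 < α → ∃ B : ℝ, 0 < B ∧ ∀ x ∈ Ω, ∀ R : ℝ, 0 < R → R ≤ 1 →
      ∀ T : ℝ, α * R ^ t ≤ T → {z ∈ Ω | d x z < T} ⊆ qball ρ x R →
      μ {z ∈ Ω | d x z < T} ≤ μ ((qball ρ x R ∩ Ω) \ {z ∈ Ω | d x z < T}) →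
      μ (qball ρ x R) ≤ ENNReal.ofReal B * μ {z ∈ Ω | d x z < T}) :
    ∃ c : ℝ, 0 < c ∧ ∀ x ∈ Ω, ∀ r : ℝ, 0 < r → r ≤ 1 → (Ω \ qball ρ x r).Nonempty →
      μ (qball ρ x r) ≤ ENNReal.ofReal c * μ (qball ρ x r ∩ Ω) := by
  obtain ⟨κ, hκ, hdoub⟩ := hdoub
  obtain ⟨hρnn, -, -, C₁, hC₁1, hC₁⟩ := hX.quasi
  have hK0 : 0 < K := by linarith
  set θ := C₁⁻¹ with hθ
  have hθ0 : 0 < θ := by positivity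
  have hθ1 : θ ≤ 1 := inv_le_one_of_one_le₀ hC₁1
  have hθC : C₁ * θ = 1 := mul_inv_cancel₀ (by positivity)
  set β := θ * (1 / (2 * K ^ 2)) ^ t⁻¹ with hβ
  have hβ0 : 0 < β := mul_pos hθ0 (Real.rpow_pos_of_pos (by positivity) _)
  have hβθ : β ≤ θ := by
    refine mul_le_of_le_one_right hθ0.le (Real.rpow_le_one (by positivity) ?_ (by positivity))
    rw [div_le_one (by positivity)]
    nlinarith
  have hβt : β ^ t = θ ^ t / (2 * K ^ 2) := by
    rw [hβ, Real.mul_rpow hθ0.le (by positivity), Real.rpow_inv_rpow (by positivity) ht.ne']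
    ring
  have hlβ0 : 0 < lam * β := mul_pos hlam0 hβ0
  have hlβθ : lam * β ≤ θ := (mul_le_of_le_one_left hβ0.le hlam1.le).trans hβθ
  set α := (lam * β) ^ t / (2 * K) with hα
  have hα0 : 0 < α := div_pos (Real.rpow_pos_of_pos hlβ0 _) (by positivity)
  have hα2 : 2 * K * α = (lam * β) ^ t := by rw [hα]; field_simp
  have hαθ : 2 * K * α ≤ θ ^ t := hα2 ▸ Real.rpow_le_rpow hlβ0.le hlβθ ht.le
  have hθt1 : θ ^ t ≤ 1 := Real.rpow_le_one hθ0.le hθ1 ht.le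
  have hθt0 : 0 < θ ^ t := Real.rpow_pos_of_pos hθ0 _
  obtain ⟨B, hB, hBbd⟩ := hdens α hα0
  refine ⟨B + (κ * θ ^ Q)⁻¹ * B, by positivity, fun x hx r hr hr1 hne => ?_⟩
  have hrt : 0 < r ^ t := Real.rpow_pos_of_pos hr _
  have hball : ∀ {y z : X} {R : ℝ}, 0 < R → ρ y z ^ t < R ^ t → ρ y z < R := fun hR h =>
    (Real.rpow_lt_rpow_iff (hρnn _ _) hR.le ht).1 h
  set U : X → Set X := fun y => {z ∈ Ω | d y z < α * r ^ t} with hU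
  have hUsub : ∀ y ∈ Ω, U y ⊆ qball ρ y (θ * r) := by
    intro y hy z hz
    refine hball (mul_pos hθ0 hr) ?_
    rw [Real.mul_rpow hθ0.le hr.le]
    have hz2 : d y z < α * r ^ t := hz.2
    calc ρ y z ^ t ≤ K * d y z := hd.rpow_le y hy z hz.1
      _ < K * (α * r ^ t) := by gcongr
      _ ≤ 2 * K * α * r ^ t := by nlinarith [mul_pos (mul_pos hK0 hα0) hrt]
      _ ≤ θ ^ t * r ^ t := by gcongr
  have hUx : U x ⊆ qball ρ x r := fun z hz =>
    lt_of_lt_of_le (hUsub x hx hz) (mul_le_of_le_one_left hr.le hθ1)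
  by_cases hhalf : μ (U x) ≤ μ ((qball ρ x r ∩ Ω) \ U x)
  · calc μ (qball ρ x r) ≤ ENNReal.ofReal B * μ (U x) :=
          hBbd x hx r hr hr1 _ le_rfl hUx hhalf
      _ ≤ ENNReal.ofReal (B + (κ * θ ^ Q)⁻¹ * B) * μ (qball ρ x r ∩ Ω) := by
          gcongr
          · exact le_add_of_nonneg_right (by positivity)
          · exact fun z hz => ⟨hUx hz, hz.1⟩
  rw [not_le] at hhalf
  have hβ1 : β ≤ 1 := hβθ.trans hθ1
  have hβr : β * r ≤ r := mul_le_of_le_one_left hr.le hβ1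
  obtain ⟨y, ⟨hyx, hyΩ⟩, hyx'⟩ := hperf x hx (β * r) (mul_pos hβ0 hr) (hβr.trans hr1)
    (hne.mono fun z hz => ⟨hz.1, fun h => hz.2 (lt_of_lt_of_le h hβr)⟩)
  have hyx : ρ x y < β * r := hyx
  have hyx' : lam * β * r ≤ ρ x y := by
    have := not_lt.1 (show ¬ ρ x y < lam * (β * r) from hyx')
    linarith
  have hyball : qball ρ y (θ * r) ⊆ qball ρ x r := by
    intro z hz
    have hz : ρ y z < θ * r := hz
    calc ρ x z ≤ C₁ * max (ρ x y) (ρ y z) := hC₁ x z y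
      _ < C₁ * (θ * r) := by
          gcongr
          exact max_lt (hyx.trans_le (by gcongr)) hz
      _ = r := by rw [← mul_assoc, hθC, one_mul]
  have hdisj : ∀ z ∈ U x, z ∉ U y := by
    intro z hzx hzy
    have h1 : d x z < α * r ^ t := hzx.2
    have h2 : d y z < α * r ^ t := hzy.2
    have h3 := hd.triangle x hx z hzx.1 y hyΩ
    rw [hd.symm z hzx.1 y hyΩ] at h3
    have h4 : (lam * β * r) ^ t ≤ K * d x y :=
      (Real.rpow_le_rpow (by positivity) hyx' ht.le).trans (hd.rpow_le x hx y hyΩ)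
    rw [Real.mul_rpow hlβ0.le hr.le, ← hα2] at h4
    nlinarith
  have hUxy : U x ⊆ qball ρ y (θ * r) := by
    intro z hz
    refine hball (mul_pos hθ0 hr) ?_
    rw [Real.mul_rpow hθ0.le hr.le]
    have hz2 : d x z < α * r ^ t := hz.2
    have h1 : d x y ≤ K * (β ^ t * r ^ t) := by
      refine (hd.le_rpow x hx y hyΩ).trans ?_
      rw [← Real.mul_rpow hβ0.le hr.le]
      gcongr
      exact hρnn x y
    have h2 := hd.triangle y hyΩ x hx z hz.1
    rw [hd.symm y hyΩ x hx] at h2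
    calc ρ y z ^ t ≤ K * d y z := hd.rpow_le y hyΩ z hz.1
      _ < K * (K * (β ^ t * r ^ t) + α * r ^ t) := by gcongr; linarith
      _ = (K ^ 2 * β ^ t + K * α) * r ^ t := by ring
      _ ≤ θ ^ t * r ^ t := by
          have h3 : K ^ 2 * β ^ t = θ ^ t / 2 := by rw [hβt]; field_simp
          gcongr
          linarith
  have hUy : U y ⊆ (qball ρ x r ∩ Ω) \ U x := fun z hz =>
    ⟨⟨hyball (hUsub y hyΩ hz), hz.1⟩, fun h => hdisj z h hz⟩
  have hyhalf : μ (U y) ≤ μ ((qball ρ y (θ * r) ∩ Ω) \ U y) :=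
    ((measure_mono hUy).trans hhalf.le).trans
      (measure_mono fun z hz => ⟨⟨hUxy hz, hz.1⟩, hdisj z hz⟩)
  have hθr : θ * r ≤ r := mul_le_of_le_one_left hr.le hθ1
  have hy := hBbd y hyΩ (θ * r) (mul_pos hθ0 hr) (hθr.trans hr1) (α * r ^ t)
    (by gcongr) (hUsub y hyΩ) hyhalf
  have hdb := hdoub y x (θ * r) r (mul_pos hθ0 hr) hθr hyball
  rw [mul_div_cancel_right₀ _ hr.ne'] at hdb
  calc μ (qball ρ x r) ≤ ENNReal.ofReal (κ * θ ^ Q)⁻¹ * μ (qball ρ y (θ * r)) :=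
        le_ofReal_inv_mul (by positivity) hdb
    _ ≤ ENNReal.ofReal (κ * θ ^ Q)⁻¹ * (ENNReal.ofReal B * μ (qball ρ x r ∩ Ω)) := by
        gcongr
        refine hy.trans ?_
        gcongr
        exact hUy.trans Set.sdiff_subset
    _ = ENNReal.ofReal ((κ * θ ^ Q)⁻¹ * B) * μ (qball ρ x r ∩ Ω) := by
        rw [ENNReal.ofReal_mul (by positivity), mul_assoc]
    _ ≤ _ := by
        gcongr
        exact le_add_of_nonneg_left hB.le

/-- Density at the radii for which the ball does not exhaust `Ω` gives density at all radii. -/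
theorem measDensity_of_forall_nonempty_diff {ρ : X → X → ℝ} {μ : Measure X} (hX : IsQMMS ρ μ)
    {Q : ℝ} (hQ : 0 < Q) (hdoub : QDoubling ρ μ Q) {Ω : Set X}
    (hΩpos : ∀ x ∈ Ω, ∀ r : ℝ, 0 < r → r ≤ 1 → 0 < μ (qball ρ x r ∩ Ω)) {c : ℝ} (hc : 0 < c)
    (h : ∀ x ∈ Ω, ∀ r : ℝ, 0 < r → r ≤ 1 → (Ω \ qball ρ x r).Nonempty →
      μ (qball ρ x r) ≤ ENNReal.ofReal c * μ (qball ρ x r ∩ Ω)) :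
    MeasDensity ρ μ Ω := by
  obtain ⟨κ, hκ, hdoub⟩ := hdoub
  obtain ⟨hρnn, hself, ⟨C₀, hC₀1, hC₀⟩, C₁, hC₁1, hC₁⟩ := hX.quasi
  rcases Ω.subsingleton_or_nontrivial with hsub | ⟨y₁, hy₁, y₂, hy₂, hne⟩
  · rcases hsub.eq_empty_or_singleton with rfl | ⟨x₀, rfl⟩
    · exact ⟨1, one_pos, fun x hx => absurd hx (Set.notMem_empty x)⟩
    have hinter : ∀ r : ℝ, 0 < r → qball ρ x₀ r ∩ {x₀} = {x₀} := fun r hr =>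
      Set.inter_eq_right.2 (Set.singleton_subset_iff.2 (by simpa [qball, (hself x₀ x₀).2 rfl]))
    have hpos : 0 < μ {x₀} := hinter 1 one_pos ▸ hΩpos x₀ rfl 1 one_pos le_rfl
    have hBtop := (hX.ball_lt_top x₀ 1 one_pos).ne
    have htop : μ {x₀} ≠ ∞ := ne_top_of_le_ne_top hBtop
      (measure_mono (hinter 1 one_pos ▸ Set.inter_subset_left))
    have hdtop : μ (qball ρ x₀ 1) / μ {x₀} ≠ ∞ := ENNReal.div_ne_top hBtop hpos.ne'
    refine ⟨(μ (qball ρ x₀ 1) / μ {x₀}).toReal, ENNReal.toReal_pos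
      (ENNReal.div_pos (hX.ball_pos x₀ 1 one_pos).ne' htop).ne' hdtop, ?_⟩
    rintro x rfl r hr hr1
    rw [hinter r hr, ENNReal.ofReal_toReal hdtop, ENNReal.div_mul_cancel hpos.ne' htop]
    exact measure_mono fun z hz => lt_of_lt_of_le hz hr1
  have hy0 : 0 < ρ y₁ y₂ := lt_of_le_of_ne (hρnn _ _) fun h => hne ((hself _ _).1 h.symm)
  set δ := min 1 (ρ y₁ y₂ / (C₁ * C₀)) with hδ
  have hδ0 : 0 < δ := lt_min one_pos (by positivity)
  have hδ1 : δ ≤ 1 := min_le_left _ _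
  have hsmall : ∀ x, ∀ r ≤ δ, (Ω \ qball ρ x r).Nonempty := by
    intro x r hr
    by_contra hcon
    rw [Set.not_nonempty_iff_eq_empty, Set.sdiff_eq_empty] at hcon
    have h1 : ρ x y₁ < r := hcon hy₁
    have h2 : ρ x y₂ < r := hcon hy₂
    have hr' : r * (C₁ * C₀) ≤ ρ y₁ y₂ :=
      (le_div_iff₀ (by positivity)).1 (hr.trans (min_le_right _ _))
    have h3 : ρ y₁ x < C₀ * r := (hC₀ x y₁).trans_lt (by gcongr)
    have hr0 : 0 ≤ r := (hρnn x y₁).trans h1.le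
    have h4 : ρ y₁ y₂ < C₁ * (C₀ * r) := by
      refine (hC₁ y₁ y₂ x).trans_lt ?_
      gcongr
      exact max_lt h3 (h2.trans_le (le_mul_of_one_le_left hr0 hC₀1))
    linarith
  refine ⟨c + (κ * δ ^ Q)⁻¹ * c, by positivity, fun x hx r hr hr1 => ?_⟩
  rcases le_or_gt r δ with hrδ | hrδ
  · refine (h x hx r hr hr1 (hsmall x r hrδ)).trans ?_
    gcongr
    exact le_add_of_nonneg_right (by positivity)
  · have hmono : qball ρ x δ ⊆ qball ρ x r := fun z hz => lt_trans hz hrδ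
    have hdb := hdoub x x δ r hδ0 hrδ.le hmono
    have hdb' : ENNReal.ofReal (κ * δ ^ Q) * μ (qball ρ x r) ≤ μ (qball ρ x δ) := by
      refine le_trans ?_ hdb
      gcongr
      exact (le_div_iff₀ hr).2 (mul_le_of_le_one_right hδ0.le hr1)
    calc μ (qball ρ x r) ≤ ENNReal.ofReal (κ * δ ^ Q)⁻¹ * μ (qball ρ x δ) :=
          le_ofReal_inv_mul (by positivity) hdb'
      _ ≤ ENNReal.ofReal (κ * δ ^ Q)⁻¹ * (ENNReal.ofReal c * μ (qball ρ x r ∩ Ω)) := by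
          gcongr
          refine (h x hx δ hδ0 hδ1 (hsmall x δ le_rfl)).trans ?_
          gcongr
      _ = ENNReal.ofReal ((κ * δ ^ Q)⁻¹ * c) * μ (qball ρ x r ∩ Ω) := by
          rw [ENNReal.ofReal_mul (by positivity), mul_assoc]
      _ ≤ _ := by
          gcongr
          exact le_add_of_nonneg_left hc.le

/-- Theorem 4.4 ((e) ⟹ (a)): a local Poincaré-type inequality for `Ṁ^s_{p,q}(Ω)` with
`s ⪯_q ind(Ω,ρ)` and `p ∈ (0,Q/s)` forces the measure density condition. -/
theorem M_poincare_implies_measure_density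
    {X : Type*} [MeasurableSpace X] (ρ : X → X → ℝ) (μ : Measure X)
    (hX : IsQMMS ρ μ) (hreg : BorelRegular μ)
    (Q : ℝ) (hQ : 0 < Q) (hdoub : QDoubling ρ μ Q)
    (Ω : Set X) (hΩmeas : MeasurableSet Ω)
    (hΩpos : ∀ x ∈ Ω, ∀ r : ℝ, 0 < r → r ≤ 1 → 0 < μ (qball ρ x r ∩ Ω))
    (hperf : ∃ lam : ℝ, 0 < lam ∧ lam < 1 ∧ LocUnifPerfect ρ Ω lam)
    (s p : ℝ) (q : ℝ≥0∞) (hs : 0 < s) (hp : 0 < p) (hpQ : p < Q / s) (hq : 0 < q)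
    (hind : SPrecIndex (fun a b : Ω => ρ a.1 b.1) s q)
    (CP : ℝ) (hCP : 0 < CP)
    (hpoin : ∀ x₀ ∈ Ω, ∀ R₀ : ℝ, 0 < R₀ → R₀ ≤ 1 →
      ∀ u : X → ℝ, AEMeasurable u (μ.restrict Ω) → MdotNorm ρ μ Ω s p q u ≠ ∞ →
        (⨅ γ : ℝ, lpOn μ (qball ρ x₀ R₀ ∩ Ω) (Q * p / (Q - s * p))
            (fun x => u x - γ)) ≤
          (ENNReal.ofReal (CP * R₀ ^ s) / μ (qball ρ x₀ R₀) ^ (s / Q)) *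
            MdotNorm ρ μ Ω s p q u) :
    MeasDensity ρ μ Ω := by
  have hsp : s * p < Q := by
    rw [lt_div_iff₀ hs] at hpQ
    linarith
  obtain ⟨lam, hlam0, hlam1, hperf⟩ := hperf
  obtain ⟨t, hst, hst', K, d, hK, hd⟩ := exists_isSnowflake hX.quasi Ω hs hind
  have hK0 : 0 < K := by linarith
  obtain ⟨c, hc, hcbd⟩ := hd.exists_measure_qball_le_inter hX hdoub (hs.trans_le hst) hK hlam0
    hlam1 hperf fun α hα => hd.exists_measure_qball_le hX hΩmeas hΩpos hQ hs hst hst' hp hsp hq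
      hK0 hCP hα hpoin
  exact measDensity_of_forall_nonempty_diff hX hQ hdoub hΩpos hc hcbd

end HajlaszPaper
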